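/- arXiv:1609.08828 — 2 statements merged into one kernel-verified Lean document; each statement's English description precedes it below -/
import Mathlib

section
/- Let B be a mutation-acyclic real skew-symmetric 3×3 matrix with C(B) = 4. Then the following are equivalent: (a) B is of finite mutation type; (b) for each pair i ≠ j there is a rational number t_ij with |b_ij| = 2cos(π·t_ij); (c) there is an integer n ≥ 2 such that B is mutation-equivalent to the skew-symmetric matrix with b_12 = 2cos(π/n), b_23 = 2cos(π/n), b_31 = 2. -/
open Matrix
noncomputable section

/-- Mutation of a real `3 × 3` matrix in direction `k`. -/
def mutate (k : Fin 3) (B : Matrix (Fin 3) (Fin 3) ℝ) : Matrix (Fin 3) (Fin 3) ℝ :=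
  Matrix.of fun i j =>
    if i = k ∨ j = k then -B i j
    else B i j + (|B i k| * B k j + B i k * |B k j|) / 2

/-- One step of mutation equivalence: a single mutation, or a simultaneous
permutation of the index set. -/
def MutationStep (B B' : Matrix (Fin 3) (Fin 3) ℝ) : Prop :=
  (∃ k : Fin 3, B' = mutate k B) ∨
  (∃ σ : Equiv.Perm (Fin 3), B' = Matrix.of fun i j => B (σ i) (σ j))

/-- Mutation equivalence: a finite sequence of mutations and simultaneous permutations. -/
def MutationEquiv : Matrix (Fin 3) (Fin 3) ℝ → Matrix (Fin 3) (Fin 3) ℝ → Prop :=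
  Relation.ReflTransGen MutationStep

/-- `B` is cyclic if `b₁₂, b₂₃, b₃₁` are all nonzero and of the same sign. -/
def IsCyclicMat (B : Matrix (Fin 3) (Fin 3) ℝ) : Prop :=
  (0 < B 0 1 ∧ 0 < B 1 2 ∧ 0 < B 2 0) ∨ (B 0 1 < 0 ∧ B 1 2 < 0 ∧ B 2 0 < 0)

instance : DecidablePred IsCyclicMat := fun B => by
  unfold IsCyclicMat; exact inferInstance

/-- `B` is mutation-cyclic if every matrix in its mutation class is cyclic. -/
def IsMutationCyclic (B : Matrix (Fin 3) (Fin 3) ℝ) : Prop :=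
  ∀ B', MutationEquiv B B' → IsCyclicMat B'

/-- `B` is mutation-acyclic if some matrix in its mutation class is acyclic. -/
def IsMutationAcyclic (B : Matrix (Fin 3) (Fin 3) ℝ) : Prop :=
  ∃ B', MutationEquiv B B' ∧ ¬ IsCyclicMat B'

/-- The Markov constant `C(B)`. -/
def markov (B : Matrix (Fin 3) (Fin 3) ℝ) : ℝ :=
  (B 0 1) ^ 2 + (B 1 2) ^ 2 + (B 2 0) ^ 2 -
    (if IsCyclicMat B then 1 else -1) * |B 0 1 * B 1 2 * B 2 0|

/-- The Lorentzian symmetric bilinear form on `ℝ^{2,1}`. -/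
def lform (x y : Fin 3 → ℝ) : ℝ := x 0 * y 0 + x 1 * y 1 - x 2 * y 2

/-- A realization of `B` by reflections: a triple of vectors of square norm `2`
whose pairwise inner products have the absolute values `|b_ij|`, with the parity
condition on the number of positive inner products. -/
def ReflRealization {V : Type*} [AddCommGroup V] [Module ℝ V]
    (f : V →ₗ[ℝ] V →ₗ[ℝ] ℝ) (B : Matrix (Fin 3) (Fin 3) ℝ) (v : Fin 3 → V) : Prop :=
  (∀ i, f (v i) (v i) = 2) ∧
  (∀ i j, i ≠ j → |f (v i) (v j)| = |B i j|) ∧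
  ((∀ i j, i ≠ j → f (v i) (v j) ≠ 0) →
    (Finset.univ.filter
        (fun p : Fin 3 × Fin 3 => p.1 < p.2 ∧ 0 < f (v p.1) (v p.2))).card % 2
      = if IsCyclicMat B then 1 else 0)

/-- Mutation of a triple of vectors by partial reflections. -/
def mutateVecRefl {V : Type*} [AddCommGroup V] [Module ℝ V]
    (f : V →ₗ[ℝ] V →ₗ[ℝ] ℝ) (B : Matrix (Fin 3) (Fin 3) ℝ) (k : Fin 3) (v : Fin 3 → V) :
    Fin 3 → V :=
  fun j =>
    if j = k then -v k
    else if 0 < B j k then v j - f (v j) (v k) • v k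
    else v j

/-- A realization of `B` by `π`-rotations: a triple of vectors in `ℝ^{2,1}` of square
norm `-2` with pairwise inner products `-|b₁₂|, -|b₂₃|, -|b₃₁|`. -/
def RotRealization (B : Matrix (Fin 3) (Fin 3) ℝ) (v : Fin 3 → (Fin 3 → ℝ)) : Prop :=
  (∀ i, lform (v i) (v i) = -2) ∧
  lform (v 0) (v 1) = -|B 0 1| ∧ lform (v 1) (v 2) = -|B 1 2| ∧
  lform (v 2) (v 0) = -|B 2 0|

/-- Mutation of a triple of points by partial `π`-rotations. -/
def mutateVecRot (B : Matrix (Fin 3) (Fin 3) ℝ) (k : Fin 3) (v : Fin 3 → (Fin 3 → ℝ)) :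
    Fin 3 → (Fin 3 → ℝ) :=
  fun j => if 0 < B j k then -v j - lform (v j) (v k) • v k else v j

/-- The cyclic matrix with weights `(2cos(π/n), 2cos(π/n), 2)`. -/
def cycQ (n : ℕ) : Matrix (Fin 3) (Fin 3) ℝ :=
  !![0, 2 * Real.cos (Real.pi / (n : ℝ)), -2;
     -(2 * Real.cos (Real.pi / (n : ℝ))), 0, 2 * Real.cos (Real.pi / (n : ℝ));
     2, -(2 * Real.cos (Real.pi / (n : ℝ))), 0]

namespace EucMut

/-- the skew matrix with given weights -/
def T (a b c : ℝ) : Matrix (Fin 3) (Fin 3) ℝ := !![0, a, -c; -a, 0, b; c, -b, 0]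

lemma skew_eq (B : Matrix (Fin 3) (Fin 3) ℝ) (hB : Bᵀ = -B) :
    B = T (B 0 1) (B 1 2) (B 2 0) := by
  have h : ∀ i j, B j i = - B i j := fun i j => by
    have := congrFun (congrFun hB i) j
    simpa using this
  have h0 := h 0 0
  have h1 := h 1 1
  have h2 := h 2 2
  have h3 := h 0 1
  have h4 := h 1 2
  have h5 := h 2 0
  ext i j
  fin_cases i <;> fin_cases j <;> simp [T] <;> linarith

lemma mutate_invol (k : Fin 3) (B : Matrix (Fin 3) (Fin 3) ℝ) : mutate k (mutate k B) = B := by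
  ext i j
  by_cases hi : i = k <;> by_cases hj : j = k <;> simp [mutate, hi, hj]
  ring

lemma step_symm {B B' : Matrix (Fin 3) (Fin 3) ℝ} (h : MutationStep B B') : MutationStep B' B := by
  rcases h with ⟨k, rfl⟩ | ⟨σ, rfl⟩
  · left; exact ⟨k, (mutate_invol k B).symm⟩
  · right; refine ⟨σ⁻¹, ?_⟩
    ext i j; simp

lemma equiv_symm {B B' : Matrix (Fin 3) (Fin 3) ℝ} (h : MutationEquiv B B') :
    MutationEquiv B' B := by
  unfold MutationEquiv at *
  induction h with
  | refl => exact Relation.ReflTransGen.refl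
  | tail _ h2 ih => exact Relation.ReflTransGen.head (step_symm h2) ih

lemma mut1 (a b c : ℝ) : mutate 1 (T a b c) = T (-a) (-b) (c - (|a| * b + a * |b|) / 2) := by
  ext i j
  fin_cases i <;> fin_cases j <;> simp [T, mutate] <;> ring

lemma mut2 (a b c : ℝ) : mutate 2 (T a b c) = T (a - (|b| * c + b * |c|) / 2) (-b) (-c) := by
  ext i j
  fin_cases i <;> fin_cases j <;> simp [T, mutate] <;> ring

lemma mut0 (a b c : ℝ) : mutate 0 (T a b c) = T (-a) (b - (|c| * a + c * |a|) / 2) (-c) := by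
  ext i j
  fin_cases i <;> fin_cases j <;> simp [T, mutate] <;> ring

lemma perm_cases (σ : Equiv.Perm (Fin 3)) :
    (σ 0 = 0 ∧ σ 1 = 1 ∧ σ 2 = 2) ∨ (σ 0 = 1 ∧ σ 1 = 2 ∧ σ 2 = 0) ∨
    (σ 0 = 2 ∧ σ 1 = 0 ∧ σ 2 = 1) ∨ (σ 0 = 2 ∧ σ 1 = 1 ∧ σ 2 = 0) ∨
    (σ 0 = 1 ∧ σ 1 = 0 ∧ σ 2 = 2) ∨ (σ 0 = 0 ∧ σ 1 = 2 ∧ σ 2 = 1) := by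
  revert σ; decide

lemma perm_T (σ : Equiv.Perm (Fin 3)) (a b c : ℝ) (P : Matrix (Fin 3) (Fin 3) ℝ → Prop)
    (h1 : P (T a b c)) (h2 : P (T b c a)) (h3 : P (T c a b))
    (h4 : P (T (-b) (-a) (-c))) (h5 : P (T (-a) (-c) (-b))) (h6 : P (T (-c) (-b) (-a))) :
    P (Matrix.of fun i j => (T a b c) (σ i) (σ j)) := by
  rcases perm_cases σ with ⟨e0, e1, e2⟩ | ⟨e0, e1, e2⟩ | ⟨e0, e1, e2⟩ | ⟨e0, e1, e2⟩ |
    ⟨e0, e1, e2⟩ | ⟨e0, e1, e2⟩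
  · convert h1; ext i j; fin_cases i <;> fin_cases j <;> simp [T, e0, e1, e2]
  · convert h2; ext i j; fin_cases i <;> fin_cases j <;> simp [T, e0, e1, e2]
  · convert h3; ext i j; fin_cases i <;> fin_cases j <;> simp [T, e0, e1, e2]
  · convert h4; ext i j; fin_cases i <;> fin_cases j <;> simp [T, e0, e1, e2]
  · convert h5; ext i j; fin_cases i <;> fin_cases j <;> simp [T, e0, e1, e2]
  · convert h6; ext i j; fin_cases i <;> fin_cases j <;> simp [T, e0, e1, e2]

lemma step_rot (a b c : ℝ) : MutationStep (T a b c) (T b c a) := by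
  right; refine ⟨finRotate 3, ?_⟩
  ext i j; fin_cases i <;> fin_cases j <;> simp [T]

lemma step_swap (a b c : ℝ) : MutationStep (T a b c) (T (-b) (-a) (-c)) := by
  right; refine ⟨Equiv.swap 0 2, ?_⟩
  have h1 : (Equiv.swap (0 : Fin 3) 2) 1 = 1 := by decide
  ext i j; fin_cases i <;> fin_cases j <;> simp [T, h1]

/-! The Markov constant on triples -/

lemma cyc_T (a b c : ℝ) : IsCyclicMat (T a b c) ↔
    (0 < a ∧ 0 < b ∧ 0 < c) ∨ (a < 0 ∧ b < 0 ∧ c < 0) := by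
  simp [IsCyclicMat, T]

def M (a b c : ℝ) : ℝ := markov (T a b c)

lemma M_eq (a b c : ℝ) : M a b c = a ^ 2 + b ^ 2 + c ^ 2 -
    (if IsCyclicMat (T a b c) then 1 else -1) * |a * b * c| := by
  simp [M, markov, T]

lemma M_rot (a b c : ℝ) : M b c a = M a b c := by
  have h : IsCyclicMat (T b c a) ↔ IsCyclicMat (T a b c) := by
    rw [cyc_T, cyc_T]; tauto
  rw [M_eq, M_eq]
  simp only [h]
  rw [show b * c * a = a * b * c by ring]; ring

lemma M_swap (a b c : ℝ) : M (-b) (-a) (-c) = M a b c := by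
  have h : IsCyclicMat (T (-b) (-a) (-c)) ↔ IsCyclicMat (T a b c) := by
    rw [cyc_T, cyc_T]; simp only [neg_pos, neg_lt_zero]; tauto
  rw [M_eq, M_eq]
  simp only [h]
  rw [show -b * -a * -c = -(a * b * c) by ring, abs_neg]; ring

lemma M_pp {a b : ℝ} (c : ℝ) (ha : 0 ≤ a) (hb : 0 ≤ b) :
    M a b c = a ^ 2 + b ^ 2 + c ^ 2 - a * b * c := by
  rw [M_eq]
  have hab := mul_nonneg ha hb
  rcases ha.eq_or_lt with rfl | ha'
  · simp
  rcases hb.eq_or_lt with rfl | hb'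
  · simp
  by_cases hc : 0 < c
  · rw [if_pos ((cyc_T _ _ _).2 (Or.inl ⟨ha', hb', hc⟩)), abs_of_nonneg (by positivity)]; ring
  · rw [if_neg, abs_of_nonpos (mul_nonpos_of_nonneg_of_nonpos hab (not_lt.1 hc))]
    · ring
    · rw [cyc_T]; rintro (h | h)
      · exact hc h.2.2
      · linarith [h.1]

lemma M_nn {a b : ℝ} (c : ℝ) (ha : a ≤ 0) (hb : b ≤ 0) :
    M a b c = a ^ 2 + b ^ 2 + c ^ 2 + a * b * c := by
  rw [← M_swap, M_pp _ (by linarith) (by linarith)]; ring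

lemma M_pn {a b : ℝ} (c : ℝ) (ha : 0 ≤ a) (hb : b ≤ 0) :
    M a b c = a ^ 2 + b ^ 2 + c ^ 2 + |a * b * c| := by
  rw [M_eq, if_neg]
  · ring
  · rw [cyc_T]; rintro (h | h) <;> linarith [h.1, h.2.1]

lemma M_np {a b : ℝ} (c : ℝ) (ha : a ≤ 0) (hb : 0 ≤ b) :
    M a b c = a ^ 2 + b ^ 2 + c ^ 2 + |a * b * c| := by
  rw [M_eq, if_neg]
  · ring
  · rw [cyc_T]; rintro (h | h) <;> linarith [h.1, h.2.1]

lemma M_mut (a b c : ℝ) : M (-a) (-b) (c - (|a| * b + a * |b|) / 2) = M a b c := by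
  rcases le_total 0 a with ha | ha <;> rcases le_total 0 b with hb | hb
  · rw [M_pp _ ha hb, M_nn _ (by linarith) (by linarith), abs_of_nonneg ha, abs_of_nonneg hb]; ring
  · rw [M_pn _ ha hb, M_np _ (by linarith) (by linarith), abs_of_nonneg ha, abs_of_nonpos hb]
    rw [show c - (a * b + a * -b) / 2 = c by ring, neg_mul_neg]; ring
  · rw [M_np _ ha hb, M_pn _ (by linarith) (by linarith), abs_of_nonpos ha, abs_of_nonneg hb]
    rw [show c - (-a * b + a * b) / 2 = c by ring, neg_mul_neg]; ring
  · rw [M_nn _ ha hb, M_pp _ (by linarith) (by linarith), abs_of_nonpos ha, abs_of_nonpos hb]; ring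

/-- A general invariance principle. -/
lemma inv_of (Q : ℝ → ℝ → ℝ → Prop)
    (hr : ∀ a b c, Q a b c → Q b c a) (hs : ∀ a b c, Q a b c → Q (-b) (-a) (-c))
    (hm : ∀ a b c, Q a b c → Q (-a) (-b) (c - (|a| * b + a * |b|) / 2))
    {B B' : Matrix (Fin 3) (Fin 3) ℝ} (h : MutationEquiv B B')
    (hB : ∃ a b c, B = T a b c ∧ Q a b c) : ∃ a b c, B' = T a b c ∧ Q a b c := by
  unfold MutationEquiv at h
  induction h with
  | refl => exact hB
  | tail _ h2 ih =>
    obtain ⟨a, b, c, rfl, hQ⟩ := ih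
    rcases h2 with ⟨k, rfl⟩ | ⟨σ, rfl⟩
    · fin_cases k
      · exact ⟨_, _, _, mut0 a b c, hr _ _ _ (hm _ _ _ (hr _ _ _ (hr _ _ _ hQ)))⟩
      · exact ⟨_, _, _, mut1 a b c, hm _ _ _ hQ⟩
      · exact ⟨_, _, _, mut2 a b c, hr _ _ _ (hr _ _ _ (hm _ _ _ (hr _ _ _ hQ)))⟩
    · apply perm_T σ a b c (fun X => ∃ a b c, X = T a b c ∧ Q a b c)
      · exact ⟨_, _, _, rfl, hQ⟩
      · exact ⟨_, _, _, rfl, hr _ _ _ hQ⟩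
      · exact ⟨_, _, _, rfl, hr _ _ _ (hr _ _ _ hQ)⟩
      · exact ⟨_, _, _, rfl, hs _ _ _ hQ⟩
      · exact ⟨_, _, _, rfl, hr _ _ _ (hs _ _ _ hQ)⟩
      · exact ⟨_, _, _, rfl, hr _ _ _ (hr _ _ _ (hs _ _ _ hQ))⟩

/-- weights with angle in `(π/N)ℤ` -/
def A (N : ℕ) (x : ℝ) : Prop := ∃ m : ℤ, |x| = 2 * Real.cos (Real.pi * m / N)

lemma A_neg {N : ℕ} {x : ℝ} (h : A N x) : A N (-x) := by
  obtain ⟨m, h⟩ := h; exact ⟨m, by rwa [abs_neg]⟩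

lemma A_cos {N : ℕ} (hN : N ≠ 0) (m : ℤ) : A N (2 * Real.cos (Real.pi * m / N)) := by
  rcases abs_choice (2 * Real.cos (Real.pi * m / N)) with h | h
  · exact ⟨m, h⟩
  · refine ⟨N - m, ?_⟩
    have hN' : (N : ℝ) ≠ 0 := by exact_mod_cast hN
    rw [h]; push_cast
    rw [show Real.pi * (N - m) / N = Real.pi - Real.pi * m / N by field_simp, Real.cos_pi_sub]; ring

lemma two_roots (α β c : ℝ) (h : (2 * Real.cos α) ^ 2 + (2 * Real.cos β) ^ 2 + c ^ 2 -
    (2 * Real.cos α) * (2 * Real.cos β) * c = 4) :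
    c = 2 * Real.cos (α + β) ∨ c = 2 * Real.cos (α - β) := by
  have : (c - 2 * Real.cos (α + β)) * (c - 2 * Real.cos (α - β)) = 0 := by
    rw [Real.cos_add, Real.cos_sub]
    have h1 := Real.sin_sq_add_cos_sq α
    have h2 := Real.sin_sq_add_cos_sq β
    have e : Real.sin α ^ 2 = 1 - Real.cos α ^ 2 := by linarith
    have e' : Real.sin β ^ 2 = 1 - Real.cos β ^ 2 := by linarith
    have e3 : (Real.sin α * Real.sin β) ^ 2 = (1 - Real.cos α ^ 2) * (1 - Real.cos β ^ 2) := by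
      rw [mul_pow, e, e']
    linear_combination h - 4 * e3
  rcases mul_eq_zero.1 this with h | h
  · left; linarith
  · right; linarith

lemma two_roots' (α β c : ℝ) (h : (2 * Real.cos α) ^ 2 + (2 * Real.cos β) ^ 2 + c ^ 2 -
    (2 * Real.cos α) * (2 * Real.cos β) * c = 4) :
    (2 * Real.cos α) * (2 * Real.cos β) - c = 2 * Real.cos (α + β) ∨
    (2 * Real.cos α) * (2 * Real.cos β) - c = 2 * Real.cos (α - β) := by
  apply two_roots; linear_combination h

lemma A_other {N : ℕ} (hN : N ≠ 0) {a b c : ℝ} (ha0 : 0 ≤ a) (hb0 : 0 ≤ b) (ha : A N a)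
    (hb : A N b) (h : a ^ 2 + b ^ 2 + c ^ 2 - a * b * c = 4) : A N (a * b - c) := by
  obtain ⟨m, hm⟩ := ha
  obtain ⟨k, hk⟩ := hb
  rw [abs_of_nonneg ha0] at hm
  rw [abs_of_nonneg hb0] at hk
  subst hm hk
  rcases two_roots' _ _ _ h with e | e
  · rw [e]; convert A_cos hN (m + k) using 3; push_cast; ring
  · rw [e]; convert A_cos hN (m - k) using 3; push_cast; ring

def Q (N : ℕ) (a b c : ℝ) : Prop := M a b c = 4 ∧ A N a ∧ A N b ∧ A N c

lemma Q_inv {N : ℕ} (hN : N ≠ 0) {B B' : Matrix (Fin 3) (Fin 3) ℝ} (h : MutationEquiv B B')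
    (hB : ∃ a b c, B = T a b c ∧ Q N a b c) : ∃ a b c, B' = T a b c ∧ Q N a b c := by
  refine inv_of (Q N) ?_ ?_ ?_ h hB
  · rintro a b c ⟨h, ha, hb, hc⟩
    exact ⟨by rw [M_rot, h], hb, hc, ha⟩
  · rintro a b c ⟨h, ha, hb, hc⟩
    exact ⟨by rw [M_swap, h], A_neg hb, A_neg ha, A_neg hc⟩
  · rintro a b c ⟨h, ha, hb, hc⟩
    refine ⟨by rw [M_mut, h], A_neg ha, A_neg hb, ?_⟩
    rcases le_total 0 a with ha0 | ha0 <;> rcases le_total 0 b with hb0 | hb0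
    · rw [M_pp _ ha0 hb0] at h
      have := A_neg (A_other hN ha0 hb0 ha hb h)
      rw [abs_of_nonneg ha0, abs_of_nonneg hb0]
      convert this using 1; ring
    · rw [abs_of_nonneg ha0, abs_of_nonpos hb0]; convert hc using 1; ring
    · rw [abs_of_nonpos ha0, abs_of_nonneg hb0]; convert hc using 1; ring
    · rw [M_nn _ ha0 hb0] at h
      have := (A_other hN (neg_nonneg.2 ha0) (neg_nonneg.2 hb0) (A_neg ha) (A_neg hb)
        (c := -c) (by linear_combination h))
      rw [abs_of_nonpos ha0, abs_of_nonpos hb0]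
      convert this using 1; ring

lemma A_finite {N : ℕ} (hN : N ≠ 0) : {x | A N x}.Finite := by
  have hN' : (N : ℝ) ≠ 0 := by exact_mod_cast hN
  have hf : ((fun m : ℤ => 2 * Real.cos (Real.pi * m / N)) '' Set.Icc 0 (2 * N)).Finite :=
    (Set.finite_Icc _ _).image _
  refine (hf.union (hf.image (fun x => -x))).subset ?_
  rintro x ⟨m, hm⟩
  have key : |x| ∈ ((fun m : ℤ => 2 * Real.cos (Real.pi * m / N)) '' Set.Icc 0 (2 * N)) := by
    have hp : (0 : ℤ) < 2 * N := by positivity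
    refine ⟨m % (2 * N), ⟨Int.emod_nonneg _ hp.ne', (Int.emod_lt_of_pos _ hp).le⟩, ?_⟩
    rw [hm]
    have e := Int.emod_add_mul_ediv m (2 * N)
    have e' : (m : ℝ) = ((m % (2 * N) : ℤ) : ℝ) + 2 * N * ((m / (2 * N) : ℤ) : ℝ) := by
      exact_mod_cast e.symm
    simp only
    congr 1
    rw [show Real.pi * m / N = Real.pi * ((m % (2 * N) : ℤ) : ℝ) / N +
      ((m / (2 * N) : ℤ) : ℝ) * (2 * Real.pi) by
        conv_lhs => rw [e']
        field_simp]
    rw [Real.cos_add_int_mul_two_pi]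
  rcases abs_choice x with h | h
  · left; rwa [h] at key
  · right; rw [h] at key; exact ⟨_, key, by simp⟩

lemma fin_of_Q {N : ℕ} (hN : N ≠ 0) {B : Matrix (Fin 3) (Fin 3) ℝ}
    (hB : ∃ a b c, B = T a b c ∧ Q N a b c) : {B' | MutationEquiv B B'}.Finite := by
  have hA := A_finite hN
  refine ((hA.prod (hA.prod hA)).image
    (fun p : ℝ × ℝ × ℝ => T p.1 p.2.1 p.2.2)).subset ?_
  intro B' h
  obtain ⟨a, b, c, rfl, -, ha, hb, hc⟩ := Q_inv hN h hB
  exact ⟨(a, b, c), ⟨ha, hb, hc⟩, rfl⟩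

/-! Descent -/

def E (B : Matrix (Fin 3) (Fin 3) ℝ) (x y z : ℝ) : Prop :=
  MutationEquiv B (T x y z) ∨ MutationEquiv B (T y x z)

variable {B : Matrix (Fin 3) (Fin 3) ℝ}

lemma e_rot {x y z : ℝ} (h : MutationEquiv B (T x y z)) : MutationEquiv B (T y z x) :=
  Relation.ReflTransGen.tail h (step_rot _ _ _)

lemma e_mut {x y z : ℝ} (hx : 0 ≤ x) (hy : 0 ≤ y) (h : MutationEquiv B (T x y z)) :
    MutationEquiv B (T y x (x * y - z)) := by
  have h1 : MutationEquiv B (T (-x) (-y) (z - (|x| * y + x * |y|) / 2)) :=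
    Relation.ReflTransGen.tail h (Or.inl ⟨1, (mut1 _ _ _).symm⟩)
  have h2 : MutationEquiv B _ := Relation.ReflTransGen.tail h1 (step_swap _ _ _)
  rw [abs_of_nonneg hx, abs_of_nonneg hy] at h2
  convert h2 using 2 <;> ring

lemma e_acyc {x y z : ℝ} (hy : 0 ≤ y) (hz : z ≤ 0) (h : MutationEquiv B (T x y z)) :
    MutationEquiv B (T (-z) x (-y)) := by
  have h1 : MutationEquiv B (T (x - (|y| * z + y * |z|) / 2) (-y) (-z)) :=
    Relation.ReflTransGen.tail h (Or.inl ⟨2, (mut2 _ _ _).symm⟩)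
  have h2 := e_rot (e_rot h1)
  rw [abs_of_nonneg hy, abs_of_nonpos hz] at h2
  convert h2 using 2; ring

lemma e_acyc' {x y z : ℝ} (hx : 0 ≤ x) (hz : z ≤ 0) (h : MutationEquiv B (T x y z)) :
    MutationEquiv B (T y (-z) (-x)) := by
  have h1 : MutationEquiv B (T (-x) (y - (|z| * x + z * |x|) / 2) (-z)) :=
    Relation.ReflTransGen.tail h (Or.inl ⟨0, (mut0 _ _ _).symm⟩)
  have h2 := e_rot h1
  rw [abs_of_nonneg hx, abs_of_nonpos hz] at h2
  convert h2 using 2; ring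

lemma E_symm {x y z : ℝ} (h : E B x y z) : E B y x z := Or.symm h

lemma E_rot {x y z : ℝ} (h : E B x y z) : E B y z x := by
  rcases h with h | h
  · exact Or.inl (e_rot h)
  · exact Or.inr (e_rot (e_rot h))

lemma E_mut {x y z : ℝ} (hx : 0 ≤ x) (hy : 0 ≤ y) (h : E B x y z) : E B x y (x * y - z) := by
  rcases h with h | h
  · exact Or.inr (e_mut hx hy h)
  · refine Or.inl ?_
    have := e_mut hy hx h
    rwa [mul_comm] at this

lemma E_acyc {x y z : ℝ} (hy : 0 ≤ y) (hz : z ≤ 0) (h : E B x y z) : E B (-z) x (-y) := by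
  rcases h with h | h
  · exact Or.inl (e_acyc hy hz h)
  · exact Or.inr (e_acyc' hy hz h)

def F (B : Matrix (Fin 3) (Fin 3) ℝ) (p q : ℝ) : Prop :=
  (0 ≤ p ∧ p ≤ Real.pi / 2) ∧ (0 ≤ q ∧ q ≤ Real.pi / 2) ∧
    E B (2 * Real.cos p) (2 * Real.cos q) (2 * Real.cos (p + q))

lemma cos_nn {p : ℝ} (h : 0 ≤ p ∧ p ≤ Real.pi / 2) : 0 ≤ 2 * Real.cos p := by
  have := Real.cos_nonneg_of_neg_pi_div_two_le_of_le (x := p) (by linarith [Real.pi_pos]) h.2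
  linarith

lemma F_symm {p q : ℝ} (h : F B p q) : F B q p := by
  refine ⟨h.2.1, h.1, ?_⟩
  rw [add_comm]; exact E_symm h.2.2

lemma F_sub {p q : ℝ} (h : F B p q) (hpq : q ≤ p) : F B q (p - q) := by
  obtain ⟨hp, hq, h⟩ := h
  refine ⟨hq, ⟨by linarith, by linarith [hp.2, hq.1]⟩, ?_⟩
  have := E_rot (E_mut (cos_nn hp) (cos_nn hq) h)
  convert this using 1
  · rw [Real.cos_add, Real.cos_sub]; ring
  · rw [show q + (p - q) = p by ring]

lemma F_add {p q : ℝ} (h : F B p q) (hpq : p + q ≤ Real.pi / 2) : F B p (p + q) := by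
  obtain ⟨hp, hq, h⟩ := h
  have hs : 0 ≤ p + q ∧ p + q ≤ Real.pi / 2 := ⟨by linarith [hp.1, hq.1], hpq⟩
  refine ⟨hp, hs, ?_⟩
  have := E_mut (cos_nn hp) (cos_nn hs) (E_symm (E_rot (E_rot h)))
  convert this using 1
  have e : q = (p + q) - p := by ring
  conv_rhs => rw [e]
  rw [Real.cos_sub (p + q) p, Real.cos_add p (p + q)]; ring_nf

lemma F_refl {p q : ℝ} (h : F B p q) (hpq : Real.pi / 2 ≤ p + q) : F B p (Real.pi - p - q) := by
  obtain ⟨hp, hq, h⟩ := h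
  have hc : 2 * Real.cos (p + q) ≤ 0 := by
    have := Real.cos_nonpos_of_pi_div_two_le_of_le hpq (by linarith [hp.2, hq.2, Real.pi_pos])
    linarith
  refine ⟨hp, ⟨by linarith [hp.2, hq.2], by linarith⟩, ?_⟩
  have := E_symm (E_acyc (cos_nn hq) hc h)
  convert this using 1
  · rw [show Real.pi - p - q = Real.pi - (p + q) by ring, Real.cos_pi_sub]; ring
  · rw [show p + (Real.pi - p - q) = Real.pi - q by ring, Real.cos_pi_sub]; ring

lemma F_finite (hfin : {B' | MutationEquiv B B'}.Finite) : {x : ℝ × ℝ | F B x.1 x.2}.Finite := by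
  let f : ℝ × ℝ → Matrix (Fin 3) (Fin 3) ℝ := fun x =>
    T (2 * Real.cos x.1) (2 * Real.cos x.2) (2 * Real.cos (x.1 + x.2))
  let R : Set (ℝ × ℝ) := {x | (0 ≤ x.1 ∧ x.1 ≤ Real.pi / 2) ∧ (0 ≤ x.2 ∧ x.2 ≤ Real.pi / 2)}
  have hinj : Set.InjOn f R := by
    rintro ⟨p, q⟩ ⟨hp, hq⟩ ⟨p', q'⟩ ⟨hp', hq'⟩ h
    simp only at hp hq hp' hq'
    have h1 := congrFun (congrFun h 0) 1
    have h2 := congrFun (congrFun h 1) 2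
    simp [f, T] at h1 h2
    have hpi := Real.pi_pos
    have e1 := Real.injOn_cos ⟨hp.1, by linarith [hp.2]⟩ ⟨hp'.1, by linarith [hp'.2]⟩ h1
    have e2 := Real.injOn_cos ⟨hq.1, by linarith [hq.2]⟩ ⟨hq'.1, by linarith [hq'.2]⟩ h2
    rw [e1, e2]
  have h1 : (R ∩ f ⁻¹' {B' | MutationEquiv B B'}).Finite := by
    apply Set.Finite.of_finite_image (f := f)
    · apply hfin.subset
      rintro _ ⟨x, hx, rfl⟩; exact hx.2
    · exact hinj.mono Set.inter_subset_left
  refine (h1.union (h1.image Prod.swap)).subset ?_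
  rintro ⟨p, q⟩ ⟨hp, hq, h | h⟩
  · left; exact ⟨⟨hp, hq⟩, h⟩
  · right; refine ⟨(q, p), ⟨⟨hq, hp⟩, ?_⟩, rfl⟩
    simp only [Set.mem_preimage, f, Set.mem_ofPred_eq]
    rw [add_comm]; exact h

lemma F_desc {g : ℝ} (n : ℕ) : ∀ r, F B g r → g * n ≤ r → F B g (r - g * n) := by
  induction n with
  | zero => intro r h _; simpa using h
  | succ n ih =>
    intro r h hr
    push_cast at hr
    have h1 := ih r h (by linarith [h.1.1])
    have h2 := F_sub (F_symm h1) (by linarith)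
    convert h2 using 1; push_cast; ring

lemma F_asc {g : ℝ} (h : F B g 0) (n : ℕ) : g * n ≤ Real.pi / 2 → F B g (g * n) := by
  induction n with
  | zero => intro _; simpa using h
  | succ n ih =>
    intro hr
    push_cast at hr
    have h1 := ih (by linarith [h.1.1])
    have h2 := F_add h1 (by linarith)
    convert h2 using 1; push_cast; ring

lemma main_desc (hfin : {B' | MutationEquiv B B'}.Finite)
    (h0 : ∃ p q, F B p q ∧ 0 < p + q) : ∃ n : ℕ, 2 ≤ n ∧ F B (Real.pi / n) 0 := by
  have hW : ({x : ℝ × ℝ | F B x.1 x.2 ∧ 0 < x.1 + x.2}).Finite :=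
    (F_finite hfin).subset fun x hx => hx.1
  obtain ⟨p0, q0, hF0, hpos0⟩ := h0
  obtain ⟨⟨p, q⟩, ⟨hF, hpos⟩, hmin⟩ :=
    Set.exists_min_image _ (fun x : ℝ × ℝ => x.1 + x.2) hW ⟨(p0, q0), hF0, hpos0⟩
  simp only at hF hpos hmin
  have hmin' : ∀ x y, F B x y → 0 < x + y → p + q ≤ x + y := fun x y h1 h2 =>
    hmin (x, y) ⟨h1, h2⟩
  -- minimal elements have a zero coordinate
  have hz : ∀ x y, F B x y → 0 < x → 0 < y → x + y ≤ p + q → False := by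
    intro x y h hx hy hle
    rcases le_total y x with hxy | hxy
    · have := hmin' _ _ (F_sub h hxy) (by linarith); linarith
    · have := hmin' _ _ (F_sub (F_symm h) hxy) (by linarith); linarith
  obtain ⟨g, hg, hFg, hgs⟩ : ∃ g, 0 < g ∧ F B g 0 ∧ g = p + q := by
    rcases hF.1.1.eq_or_lt with hp | hp
    · refine ⟨q, by linarith, ?_, by linarith⟩
      rw [← hp] at hF; exact F_symm hF
    · rcases hF.2.1.1.eq_or_lt with hq | hq
      · refine ⟨p, by linarith, ?_, by linarith⟩
        rw [← hq] at hF; exact hF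
      · exact (hz p q hF hp hq le_rfl).elim
  have hpi := Real.pi_pos
  set k := ⌊Real.pi / 2 / g⌋₊ with hk
  have hk1 : g * k ≤ Real.pi / 2 := by
    have := Nat.floor_le (a := Real.pi / 2 / g) (by positivity)
    rw [le_div_iff₀ hg] at this; linarith
  have hk2 : Real.pi / 2 < g * (k + 1) := by
    have := Nat.lt_floor_add_one (Real.pi / 2 / g)
    rw [div_lt_iff₀ hg] at this; linarith
  have h1 := F_refl (F_asc hFg k hk1) (by linarith)
  set r := Real.pi - g - g * k with hr
  have hr0 : 0 ≤ r := h1.2.1.1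
  set j := ⌊r / g⌋₊ with hj
  have hj1 : g * j ≤ r := by
    have := Nat.floor_le (a := r / g) (by positivity)
    rw [le_div_iff₀ hg] at this; linarith
  have hj2 : r < g * (j + 1) := by
    have := Nat.lt_floor_add_one (r / g)
    rw [div_lt_iff₀ hg] at this; linarith
  have h2 := F_desc j r h1 hj1
  have h3 : r - g * j = 0 := by
    by_contra hne
    have hpos' : 0 < r - g * j := lt_of_le_of_ne (by linarith) (Ne.symm hne)
    exact hz _ _ (F_sub h2 (by linarith)) hpos' (by linarith) (by linarith)
  have hn : Real.pi = g * ((k + j + 1 : ℕ) : ℝ) := by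
    push_cast; linarith
  refine ⟨k + j + 1, ?_, ?_⟩
  · by_contra hlt
    have : ((k + j + 1 : ℕ) : ℝ) ≤ 1 := by exact_mod_cast (by omega : k + j + 1 ≤ 1)
    have h5 : g ≤ Real.pi / 2 := hFg.1.2
    nlinarith
  · have : Real.pi / ((k + j + 1 : ℕ) : ℝ) = g := by
      rw [div_eq_iff (by positivity)]; exact hn
    rw [this]; exact hFg

lemma cyc_of_F {n : ℕ} (h : F B (Real.pi / n) 0) : MutationEquiv B (cycQ n) := by
  obtain ⟨-, -, h⟩ := h
  have e : cycQ n = T (2 * Real.cos (Real.pi / n)) (2 * Real.cos (Real.pi / n)) 2 := by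
    simp [cycQ, T]
  rw [e]
  rw [Real.cos_zero, add_zero, mul_one] at h
  rcases h with h | h
  · exact e_rot (e_rot h)
  · exact e_rot h

/-- an acyclic normal form has angles -/
lemma F_of_acyc {a b c : ℝ} (ha : 0 ≤ a) (hb : 0 ≤ b) (hc : c ≤ 0)
    (hM : M a b c = 4) (h : MutationEquiv B (T a b c)) : ∃ p q, F B p q ∧ 0 < p + q := by
  rw [M_pp _ ha hb] at hM
  have hab := mul_nonneg ha hb
  have habc := mul_nonneg hab (neg_nonneg.2 hc)
  have ha2 : a ≤ 2 := by nlinarith [sq_nonneg b, sq_nonneg c]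
  have hb2 : b ≤ 2 := by nlinarith [sq_nonneg a, sq_nonneg c]
  have hpi := Real.pi_pos
  obtain ⟨p, hp, rfl⟩ : ∃ p, (0 ≤ p ∧ p ≤ Real.pi / 2) ∧ 2 * Real.cos p = a :=
    ⟨Real.arccos (a / 2), ⟨Real.arccos_nonneg _, Real.arccos_le_pi_div_two.2 (by linarith)⟩,
      by rw [Real.cos_arccos (by linarith) (by linarith)]; ring⟩
  obtain ⟨q, hq, rfl⟩ : ∃ p, (0 ≤ p ∧ p ≤ Real.pi / 2) ∧ 2 * Real.cos p = b :=
    ⟨Real.arccos (b / 2), ⟨Real.arccos_nonneg _, Real.arccos_le_pi_div_two.2 (by linarith)⟩,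
      by rw [Real.cos_arccos (by linarith) (by linarith)]; ring⟩
  have hcp : c = 2 * Real.cos (p + q) := by
    rcases two_roots _ _ _ hM with e | e
    · exact e
    · have h1 : 0 ≤ Real.sin p * Real.sin q :=
        mul_nonneg (Real.sin_nonneg_of_nonneg_of_le_pi hp.1 (by linarith [hp.2]))
          (Real.sin_nonneg_of_nonneg_of_le_pi hq.1 (by linarith [hq.2]))
      rw [Real.cos_sub] at e
      rw [Real.cos_add]
      nlinarith
  refine ⟨p, q, ⟨hp, hq, Or.inl (hcp ▸ h)⟩, ?_⟩
  by_contra hle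
  have e : p + q = 0 := le_antisymm (not_lt.1 hle) (by linarith [hp.1, hq.1])
  rw [e, Real.cos_zero] at hcp; linarith

lemma F_exists {a b c : ℝ} (hn : ¬ IsCyclicMat (T a b c)) (hM : M a b c = 4)
    (h : MutationEquiv B (T a b c)) : ∃ p q, F B p q ∧ 0 < p + q := by
  have sw : ∀ {x y z : ℝ}, MutationEquiv B (T x y z) → MutationEquiv B (T (-y) (-x) (-z)) :=
    fun h => Relation.ReflTransGen.tail h (step_swap _ _ _)
  have key : ∀ x y z : ℝ, 0 ≤ x → 0 ≤ y → z ≤ 0 → M x y z = 4 → MutationEquiv B (T x y z) →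
      ∃ p q, F B p q ∧ 0 < p + q := fun x y z h1 h2 h3 h4 h5 => F_of_acyc h1 h2 h3 h4 h5
  have key' : ∀ x y z : ℝ, x ≤ 0 → y ≤ 0 → 0 ≤ z → M x y z = 4 → MutationEquiv B (T x y z) →
      ∃ p q, F B p q ∧ 0 < p + q := fun x y z h1 h2 h3 h4 h5 =>
    key _ _ _ (neg_nonneg.2 h2) (neg_nonneg.2 h1) (neg_nonpos.2 h3) (by rw [M_swap, h4]) (sw h5)
  have M1 : M b c a = 4 := by rw [M_rot, hM]
  have M2 : M c a b = 4 := by rw [M_rot, M1]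
  have r1 := e_rot h
  have r2 := e_rot r1
  rw [cyc_T] at hn
  push Not at hn
  obtain ⟨n1, n2⟩ := hn
  rcases le_total 0 a with ha | ha <;> rcases le_total 0 b with hb | hb <;>
    rcases le_total 0 c with hc | hc
  · rcases ha.eq_or_lt with e | ha'
    · exact key _ _ _ hb hc e.ge M1 r1
    rcases hb.eq_or_lt with e | hb'
    · exact key _ _ _ hc ha e.ge M2 r2
    exact key _ _ _ ha hb (n1 ha' hb') hM h
  · exact key _ _ _ ha hb hc hM h
  · exact key _ _ _ hc ha hb M2 r2
  · exact key' _ _ _ hb hc ha M1 r1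
  · exact key _ _ _ hb hc ha M1 r1
  · exact key' _ _ _ hc ha hb M2 r2
  · exact key' _ _ _ ha hb hc hM h
  · rcases ha.eq_or_lt with e | ha'
    · exact key' _ _ _ hb hc e.ge M1 r1
    rcases hb.eq_or_lt with e | hb'
    · exact key' _ _ _ hc ha e.ge M2 r2
    exact key' _ _ _ ha hb (n2 ha' hb') hM h

lemma A_of_rat {x : ℝ} {t : ℚ} (h : |x| = 2 * Real.cos (Real.pi * (t : ℝ))) (K : ℕ) (hK : K ≠ 0) :
    A (t.den * K) x := by
  refine ⟨t.num * K, ?_⟩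
  rw [h]
  have h1 : (t.den : ℝ) ≠ 0 := by exact_mod_cast t.den_nz
  have h2 : (K : ℝ) ≠ 0 := by exact_mod_cast hK
  have h3 : (t : ℝ) = t.num / t.den := by exact_mod_cast (Rat.num_div_den t).symm
  rw [h3]; push_cast
  congr 2
  field_simp

lemma rat_of_A {x : ℝ} {N : ℕ} (h : A N x) :
    ∃ t : ℚ, |x| = 2 * Real.cos (Real.pi * (t : ℝ)) := by
  obtain ⟨m, h⟩ := h
  refine ⟨m / N, ?_⟩
  rw [h]; push_cast; rw [mul_div_assoc]

theorem main (B : Matrix (Fin 3) (Fin 3) ℝ) (hB : Bᵀ = -B)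
    (hac : IsMutationAcyclic B) (hC : markov B = 4) :
    ({B' | MutationEquiv B B'}.Finite ↔
      ∀ i j : Fin 3, i ≠ j → ∃ t : ℚ, |B i j| = 2 * Real.cos (Real.pi * (t : ℝ))) ∧
    ({B' | MutationEquiv B B'}.Finite ↔
      ∃ n : ℕ, 2 ≤ n ∧ MutationEquiv B (cycQ n)) := by
  have hT := skew_eq B hB
  have hM : M (B 0 1) (B 1 2) (B 2 0) = 4 := by unfold M; rw [← hT]; exact hC
  have hMinv : ∀ B', MutationEquiv B B' → ∃ a b c, B' = T a b c ∧ M a b c = 4 := by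
    intro B' h
    refine inv_of (fun a b c => M a b c = 4) ?_ ?_ ?_ h ⟨_, _, _, hT, hM⟩
    · intro a b c h; rw [M_rot, h]
    · intro a b c h; rw [M_swap, h]
    · intro a b c h; rw [M_mut, h]
  have ac : {B' | MutationEquiv B B'}.Finite → ∃ n : ℕ, 2 ≤ n ∧ MutationEquiv B (cycQ n) := by
    intro hfin
    obtain ⟨B', hB', hn⟩ := hac
    obtain ⟨a, b, c, rfl, h4⟩ := hMinv B' hB'
    obtain ⟨n, hn, hF⟩ := main_desc hfin (F_exists hn h4 hB')
    exact ⟨n, hn, cyc_of_F hF⟩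
  have cQ : (∃ n : ℕ, 2 ≤ n ∧ MutationEquiv B (cycQ n)) →
      ∃ N : ℕ, N ≠ 0 ∧ ∃ a b c, B = T a b c ∧ Q N a b c := by
    rintro ⟨n, hn, h⟩
    have hn0 : n ≠ 0 := by omega
    refine ⟨n, hn0, Q_inv hn0 (equiv_symm h) ?_⟩
    have e : cycQ n = T (2 * Real.cos (Real.pi / n)) (2 * Real.cos (Real.pi / n)) 2 := by
      simp [cycQ, T]
    obtain ⟨a, b, c, e', h4⟩ := hMinv _ h
    have hM' : M (2 * Real.cos (Real.pi / n)) (2 * Real.cos (Real.pi / n)) 2 = 4 := by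
      unfold M at *; rw [← e, e', h4]
    have A1 : A n (2 * Real.cos (Real.pi / n)) := by simpa using A_cos hn0 1
    have A2 : A n 2 := by simpa using A_cos hn0 0
    exact ⟨_, _, _, e, hM', A1, A1, A2⟩
  have Qa : (∃ N : ℕ, N ≠ 0 ∧ ∃ a b c, B = T a b c ∧ Q N a b c) →
      {B' | MutationEquiv B B'}.Finite := fun ⟨N, hN, h⟩ => fin_of_Q hN h
  have Qb : (∃ N : ℕ, N ≠ 0 ∧ ∃ a b c, B = T a b c ∧ Q N a b c) →
      ∀ i j : Fin 3, i ≠ j → ∃ t : ℚ, |B i j| = 2 * Real.cos (Real.pi * (t : ℝ)) := by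
    rintro ⟨N, hN, a, b, c, e, -, ha, hb, hc⟩ i j hij
    rw [e]
    fin_cases i <;> fin_cases j <;> simp [T] at hij ⊢ <;>
      first
        | exact rat_of_A ha
        | exact rat_of_A hb
        | exact rat_of_A hc
  have bQ : (∀ i j : Fin 3, i ≠ j → ∃ t : ℚ, |B i j| = 2 * Real.cos (Real.pi * (t : ℝ))) →
      ∃ N : ℕ, N ≠ 0 ∧ ∃ a b c, B = T a b c ∧ Q N a b c := by
    intro h
    obtain ⟨t, ht⟩ := h 0 1 (by decide)
    obtain ⟨u, hu⟩ := h 1 2 (by decide)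
    obtain ⟨v, hv⟩ := h 2 0 (by decide)
    have z1 := t.den_nz
    have z2 := u.den_nz
    have z3 := v.den_nz
    refine ⟨t.den * (u.den * v.den), by positivity, _, _, _, hT, hM, ?_, ?_, ?_⟩
    · exact A_of_rat ht _ (by positivity)
    · convert A_of_rat hu (t.den * v.den) (by positivity) using 1; ring
    · convert A_of_rat hv (t.den * u.den) (by positivity) using 1; ring
  exact ⟨⟨fun h => Qb (cQ (ac h)), fun h => Qa (bQ h)⟩, ⟨ac, fun h => Qa (cQ h)⟩⟩

end EucMut

/-- for a mutation-acyclic matrix with Markov constant 4, finiteness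
of the mutation class is equivalent to all weights being of the form `2cos(πt)`
with `t` rational, and equivalent to being mutation-equivalent to
`(2cos(π/n), 2cos(π/n), 2)` for some integer `n ≥ 2`. -/
theorem finite_mutation_type_iff_euclidean
    (B : Matrix (Fin 3) (Fin 3) ℝ) (hB : Bᵀ = -B)
    (hac : IsMutationAcyclic B) (hC : markov B = 4) :
    ({B' | MutationEquiv B B'}.Finite ↔
      ∀ i j : Fin 3, i ≠ j → ∃ t : ℚ, |B i j| = 2 * Real.cos (Real.pi * (t : ℝ))) ∧
    ({B' | MutationEquiv B B'}.Finite ↔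
      ∃ n : ℕ, 2 ≤ n ∧ MutationEquiv B (cycQ n)) := by
  exact EucMut.main B hB hac hC
end
end

section
/- Let B be a connected real skew-symmetric 3×3 matrix, i.e. at least two of b_12, b_13, b_23 are nonzero. Then B is of finite mutation type if and only if B is mutation-equivalent to one of the following skew-symmetric matrices: (1) the Markov quiver, with b_12 = b_23 = b_31 = 2; (2) the matrix with b_12 = b_23 = 2cos(π/n), b_31 = 2, for some integer n ≥ 2; (3) one of the five acyclic matrices with b_31 = 0 and (b_12, b_23) equal to (1,1), (1,√2), (1, 2cos(π/5)), (2cos(π/5), 2cos(2π/5)), or (1, 2cos(2π/5)). -/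
open Matrix
noncomputable section

/-- The Markov quiver `(2,2,2)`. -/
def markovQ : Matrix (Fin 3) (Fin 3) ℝ :=
  !![0, 2, -2; -2, 0, 2; 2, -2, 0]

/-- The acyclic matrix with weights `b₁₂ = p`, `b₂₃ = q`, `b₃₁ = 0`. -/
def acQ (p q : ℝ) : Matrix (Fin 3) (Fin 3) ℝ :=
  !![0, p, 0; -p, 0, q; 0, -q, 0]

/-- Finite, connected set of triples closed under the Vieta moves. -/
structure FO (O : ℝ → ℝ → ℝ → Prop) (M : ℝ) : Prop where
  fin : {p : ℝ × ℝ × ℝ | O p.1 p.2.1 p.2.2}.Finite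
  rot : ∀ {x y z}, O x y z → O y z x
  swp : ∀ {x y z}, O x y z → O y x z
  sgn : ∀ {x y z}, O x y z → O (-x) (-y) z
  vie : ∀ {x y z}, O x y z → O x y (x * y - z)
  conn : ∀ {x y z}, O x y z → y = 0 → z = 0 → False
  inv : ∀ {x y z}, O x y z → x ^ 2 + y ^ 2 + z ^ 2 - x * y * z = M

namespace FO
variable {O : ℝ → ℝ → ℝ → Prop} {M : ℝ}

theorem sw2 (h : FO O M) {x y z : ℝ} (t : O x y z) : O x z y :=
  h.rot (h.rot (h.swp (h.rot t)))

theorem step (h : FO O M) {x y z : ℝ} (t : O x y z) : O x z (x * z - y) :=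
  h.vie (h.sw2 t)

theorem neg2 (h : FO O M) {x y z : ℝ} (t : O x y z) : O x (-y) (-z) :=
  h.rot (h.rot (h.sgn (h.rot t)))

theorem maxfix (h : FO O M) {x y₀ z₀ : ℝ} (t : O x y₀ z₀) :
    ∃ y z, O x y z ∧ 0 < y ∧ |z| ≤ y ∧ |x * y - z| ≤ y ∧ 0 ≤ x * z ∧ 0 ≤ x * (x * y - z)
      ∧ ∀ y' z', O x y' z' → |y'| ≤ y := by
  have hf : {p : ℝ × ℝ × ℝ | O p.1 p.2.1 p.2.2 ∧ p.1 = x}.Finite :=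
    h.fin.subset (fun p hp => hp.1)
  obtain ⟨⟨a, b, c⟩, ⟨hp, ha⟩, hmax⟩ := Set.exists_max_image _ (fun p : ℝ × ℝ × ℝ => |p.2.1|) hf
    ⟨(x, y₀, z₀), t, rfl⟩
  simp only at hp ha hmax
  subst ha
  have key : ∃ y z, O a y z ∧ 0 ≤ y ∧ |b| = y := by
    rcases le_total 0 b with hb | hb
    · exact ⟨b, c, hp, hb, abs_of_nonneg hb⟩
    · exact ⟨-b, -c, h.neg2 hp, by linarith, abs_of_nonpos hb⟩
  obtain ⟨y, z, hO, hy, hby⟩ := key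
  have hm : ∀ y' z', O a y' z' → |y'| ≤ y := fun y' z' h' => by
    rw [← hby]; exact hmax (a, y', z') ⟨h', rfl⟩
  have hz := hm _ _ (h.sw2 hO)
  have hz' := hm _ _ (h.sw2 (h.vie hO))
  have h1 := hm _ _ (h.sw2 (h.step hO))
  have h2 := hm _ _ (h.sw2 (h.step (h.vie hO)))
  have hy' : 0 < y := by
    rcases hy.eq_or_lt with e | e
    · exfalso
      apply h.conn hO e.symm
      rw [← e] at hz
      simpa using hz
    · exact e
  exact ⟨y, z, hO, hy', hz, hz', by linarith [neg_abs_le (a * z - y)],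
    by linarith [neg_abs_le (a * (a * y - z) - y)], hm⟩

/-- with `x = 2`-ish: everything with `x ≥ 2` is `x = 2` -/
theorem big (h : FO O M) {x y₀ z₀ : ℝ} (t : O x y₀ z₀) (hx : 2 ≤ x) : x = 2 ∧ y₀ ^ 2 = z₀ ^ 2 ∧ M = 4
    ∧ (0 ≤ y₀ * z₀) := by
  obtain ⟨y, z, hO, hy, hz, hz', h1, h2, -⟩ := h.maxfix t
  have a1 := le_abs_self z
  have a2 := le_abs_self (x * y - z)
  have hx2 : x = 2 := by nlinarith
  subst hx2
  have : z = y := by linarith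
  subst this
  have e1 := h.inv hO
  have e2 := h.inv t
  have : (y₀ - z₀) ^ 2 = 0 := by nlinarith
  have e3 : y₀ = z₀ := by
    have := pow_eq_zero_iff (two_ne_zero) |>.1 this
    linarith
  subst e3
  refine ⟨rfl, rfl, by nlinarith, mul_self_nonneg _⟩

theorem lower (h : FO O M) {x y₀ z₀ : ℝ} (t : O x y₀ z₀) (hx : 0 < x) :
    ∃ y z, O y x z ∧ M - x ^ 2 ≤ y ^ 2 ∧ 0 < y := by
  obtain ⟨y, z, hO, hy, hz, hz', h1, h2, -⟩ := h.maxfix t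
  refine ⟨y, z, h.swp hO, ?_, hy⟩
  have e := h.inv hO
  have h1' : 0 ≤ z := by by_contra hc; nlinarith
  have h2' : 0 ≤ x * y - z := by by_contra hc; nlinarith
  nlinarith [mul_nonneg h1' h2']

/-- if all neighbours of `m` are bounded by `m < 2`, then `M < 4`. -/
theorem lt4 (h : FO O M) {m y₀ z₀ : ℝ} (t : O m y₀ z₀) (hm : 0 < m) (hm2 : m < 2)
    (hb : ∀ y z, O m y z → |y| ≤ m) : M < 4 := by
  obtain ⟨y, z, hO, hy, hz, hz', h1, h2, -⟩ := h.maxfix t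
  have e := h.inv hO
  have hym : y ≤ m := (le_abs_self y).trans (hb _ _ hO)
  have a1 := le_abs_self z
  have a2 := le_abs_self (m * y - z)
  have e2 : 0 ≤ (y - z) * (y - (m * y - z)) := mul_nonneg (by linarith) (by linarith)
  -- z^2 - m y z ≤ y^2 (1 - m)
  have e3 : M ≤ m ^ 2 + y ^ 2 * (2 - m) := by nlinarith
  have e4 : y ^ 2 * (2 - m) ≤ m ^ 2 * (2 - m) := by
    apply mul_le_mul_of_nonneg_right _ (by linarith)
    nlinarith
  have e5 : 0 < (m - 2) ^ 2 * (m + 1) := by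
    have : m - 2 ≠ 0 := by linarith
    positivity
  nlinarith

theorem exists_max (h : FO O M) {x y z : ℝ} (t : O x y z) :
    ∃ m, (∃ y z, O m y z) ∧ 0 < m ∧ ∀ a b c, O a b c → |a| ≤ m := by
  obtain ⟨⟨a, b, c⟩, hp, hmax⟩ := Set.exists_max_image _ (fun p : ℝ × ℝ × ℝ => |p.1|) h.fin
    ⟨(x, y, z), t⟩
  simp only [Set.mem_ofPred_eq] at hp hmax
  have hm : ∀ a' b' c', O a' b' c' → |a'| ≤ |a| := fun a' b' c' h' => hmax (a', b', c') h'
  refine ⟨|a|, ?_, ?_, hm⟩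
  · rcases abs_choice a with e | e <;> rw [e]
    · exact ⟨b, c, hp⟩
    · exact ⟨-b, c, h.sgn hp⟩
  · by_contra hc
    have ha : |a| = 0 := le_antisymm (not_lt.1 hc) (abs_nonneg a)
    have h1 := hm _ _ _ (h.rot hp)
    have h2 := hm _ _ _ (h.rot (h.rot hp))
    rw [ha] at h1 h2
    exact h.conn hp (by simpa using h1) (by simpa using h2)

theorem le4 (h : FO O M) {x y z : ℝ} (t : O x y z) : M ≤ 4 := by
  obtain ⟨m, ⟨y, z, hO⟩, hm, hmax⟩ := h.exists_max t
  rcases lt_or_ge m 2 with h2 | h2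
  · exact (h.lt4 hO hm h2 fun y' z' h' => hmax _ _ _ (h.swp h')).le
  · exact (h.big hO h2).2.2.1.le

theorem exists_min (h : FO O M) {x y z : ℝ} (t : O x y z) :
    ∃ m, (∃ y z, O m y z) ∧ 0 < m ∧ ∀ a b c, O a b c → a ≠ 0 → m ≤ |a| := by
  obtain ⟨m, ⟨y, z, hO⟩, hm, -⟩ := h.exists_max t
  have hf : {p : ℝ × ℝ × ℝ | O p.1 p.2.1 p.2.2 ∧ p.1 ≠ 0}.Finite :=
    h.fin.subset (fun p hp => hp.1)
  obtain ⟨⟨a, b, c⟩, ⟨hp, ha⟩, hmax⟩ := Set.exists_min_image _ (fun p : ℝ × ℝ × ℝ => |p.1|) hf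
    ⟨(m, y, z), hO, hm.ne'⟩
  simp only at hp ha hmax
  refine ⟨|a|, ?_, abs_pos.2 ha, fun a' b' c' h' h0 => hmax (a', b', c') ⟨h', h0⟩⟩
  rcases abs_choice a with e | e <;> rw [e]
  · exact ⟨b, c, hp⟩
  · exact ⟨-b, c, h.sgn hp⟩

/-- Main extremal lemma in the case of all entries `< 2`. -/
theorem extremal (h : FO O M) {m y₀ z₀ : ℝ} (t : O m y₀ z₀) (hm : 0 < m) (hm2 : m < 2)
    (hmax : ∀ a b c, O a b c → |a| ≤ m) :
    ∃ v, O m v 0 ∧ 0 < v ∧ ∀ a b c, O a b c → a ≠ 0 → v ≤ |a| := by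
  obtain ⟨v, ⟨yv, zv, hv⟩, hv0, hmin⟩ := h.exists_min t
  obtain ⟨y, z, hyz, hy, hypos⟩ := h.lower hv hv0
  have hym : y ≤ m := (le_abs_self y).trans (hmax _ _ _ hyz)
  have hMv : M - m ^ 2 ≤ v ^ 2 := by nlinarith
  -- a pair with nonpositive product
  have key : ∃ y z, O m y z ∧ y * z ≤ 0 := by
    by_contra hc
    push Not at hc
    have hf : {p : ℝ × ℝ × ℝ | O p.1 p.2.1 p.2.2 ∧ p.1 = m}.Finite :=
      h.fin.subset (fun p hp => hp.1)
    obtain ⟨⟨a, b, c⟩, ⟨hp, ha⟩, hmn⟩ := Set.exists_min_image _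
      (fun p : ℝ × ℝ × ℝ => |p.2.1|) hf ⟨(m, y₀, z₀), t, rfl⟩
    simp only at hp ha hmn
    subst ha
    have hm' : ∀ y' z', O a y' z' → |b| ≤ |y'| := fun y' z' h' => hmn (a, y', z') ⟨h', rfl⟩
    have h1 := hm' _ _ (h.sw2 hp)
    have h2 := hm' _ _ (h.sw2 (h.vie hp))
    have p1 := hc _ _ hp
    have p2 := hc _ _ (h.vie hp)
    rcases lt_trichotomy b 0 with hb | hb | hb
    · have q1 : c < 0 := by by_contra hcc; nlinarith
      have q2 : a * b - c < 0 := by by_contra hcc; nlinarith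
      rw [abs_of_neg hb, abs_of_neg q1] at h1
      rw [abs_of_neg hb, abs_of_neg q2] at h2
      nlinarith
    · subst hb; simp at p1
    · have q1 : 0 < c := by by_contra hcc; nlinarith
      have q2 : 0 < a * b - c := by by_contra hcc; nlinarith
      rw [abs_of_pos hb, abs_of_pos q1] at h1
      rw [abs_of_pos hb, abs_of_pos q2] at h2
      nlinarith
  obtain ⟨y, z, hO, hyz⟩ := key
  have e := h.inv hO
  have ex : ∃ w, O m w 0 := by
    by_cases hz : z = 0
    · subst hz; exact ⟨y, hO⟩
    by_cases hy0 : y = 0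
    · subst hy0; exact ⟨z, h.sw2 hO⟩
    exfalso
    have h1 := hmin _ _ _ (h.rot hO) hy0
    have h2 := hmin _ _ _ (h.rot (h.rot hO)) hz
    have h1' : v ^ 2 ≤ y ^ 2 := by rw [← sq_abs y]; gcongr
    have h2' : v ^ 2 ≤ z ^ 2 := by rw [← sq_abs z]; gcongr
    nlinarith [mul_nonneg hm.le (neg_nonneg.2 hyz), mul_pos hv0 hv0]
  obtain ⟨w, hw⟩ := ex
  have hw0 : w ≠ 0 := fun hc => h.conn hw hc rfl
  have ew := h.inv hw
  have hwv := hmin _ _ _ (h.rot hw) hw0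
  have : |w| = v := by
    apply le_antisymm _ hwv
    have : |w| ^ 2 ≤ v ^ 2 := by rw [sq_abs]; nlinarith
    exact abs_le_of_sq_le_sq' (by simpa using this) hv0.le |>.2
  refine ⟨v, ?_, hv0, hmin⟩
  rcases abs_choice w with e' | e'
  · rw [← this, e']; exact hw
  · rw [← this, e']; simpa using h.neg2 hw

end FO

open Real in
theorem ceil_aux {α : ℝ} (h0 : 0 < α) :
    ∃ k : ℕ, 1 ≤ k ∧ Real.pi ≤ k * α ∧ k * α < Real.pi + α := by
  refine ⟨⌈Real.pi / α⌉₊, ?_, ?_, ?_⟩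
  · exact Nat.one_le_ceil_iff.2 (div_pos pi_pos h0)
  · have := Nat.le_ceil (Real.pi / α)
    rwa [div_le_iff₀ h0] at this
  · have := Nat.ceil_lt_add_one (div_pos pi_pos h0).le
    calc _ < (Real.pi / α + 1) * α := by gcongr
      _ = _ := by field_simp

theorem ang_aux {m : ℝ} (h0 : 0 < m) (h2 : m < 2) :
    ∃ α, 0 < α ∧ α < Real.pi / 2 ∧ m = 2 * Real.cos α := by
  refine ⟨Real.arccos (m / 2), Real.arccos_pos.2 (by linarith), Real.arccos_lt_pi_div_two.2 (by linarith), ?_⟩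
  rw [Real.cos_arccos (by linarith) (by linarith)]; ring

namespace FO
variable {O : ℝ → ℝ → ℝ → Prop} {M : ℝ}

theorem diag2 (h : FO O M) {y z : ℝ} (t : O 2 y z) : z = y := by
  obtain ⟨-, h1, -, h2⟩ := h.big t le_rfl
  rcases sq_eq_sq_iff_eq_or_eq_neg.1 h1 with e | e
  · exact e.symm
  · subst e
    have : z = 0 := by nlinarith
    subst this; simp

theorem cosseq (h : FO O M) {α : ℝ} (t : O (2 * Real.cos α) 2 (2 * Real.cos α)) (j : ℕ) :
    O (2 * Real.cos α) (2 * Real.cos (j * α)) (2 * Real.cos ((j + 1 : ℕ) * α)) := by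
  induction j with
  | zero => simpa using t
  | succ j ih =>
    have := h.step ih
    convert this using 1
    have e1 : ((j + 1 + 1 : ℕ) : ℝ) * α = ((j + 1 : ℕ) : ℝ) * α + α := by push_cast; ring
    have e2 : (j : ℝ) * α = ((j + 1 : ℕ) : ℝ) * α - α := by push_cast; ring
    rw [e1, e2, Real.cos_add, Real.cos_sub]; ring

theorem case2 (h : FO O M) {y z : ℝ} (t : O 2 y z) :
    O 2 2 2 ∨ ∃ n : ℕ, 3 ≤ n ∧ O (2 * Real.cos (Real.pi / n)) (2 * Real.cos (Real.pi / n)) 2 := by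
  have hM : M = 4 := (h.big t le_rfl).2.2.1
  have := h.diag2 t
  subst this
  have hz0 : z ≠ 0 := fun hc => h.conn t hc hc
  have hle : ∀ a b c, O a b c → |a| ≤ 2 := by
    intro a b c h'
    rcases abs_choice a with e | e <;> rw [e] <;> by_contra hc <;> push Not at hc
    · exact hc.ne' (h.big h' hc.le).1
    · exact hc.ne' (h.big (h.sgn h') hc.le).1
  by_cases hz : |z| = 2
  · left
    rcases abs_choice z with e | e
    · rw [← e, hz] at t; exact t
    · have e' : z = -2 := by linarith
      subst e'; simpa using h.neg2 t
  right
  have hzlt : |z| < 2 := lt_of_le_of_ne (hle _ _ _ (h.swp t)) hz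
  have t' : ∃ b c, O |z| b c := by
    rcases abs_choice z with e | e <;> rw [e]
    · exact ⟨_, _, h.swp t⟩
    · exact ⟨_, _, h.sgn (h.swp t)⟩
  obtain ⟨b₀, c₀, t'⟩ := t'
  have hf : {p : ℝ × ℝ × ℝ | O p.1 p.2.1 p.2.2 ∧ p.1 < 2}.Finite :=
    h.fin.subset (fun p hp => hp.1)
  obtain ⟨⟨m, b, c⟩, ⟨hp, hm2⟩, hmax⟩ := Set.exists_max_image _ (fun p : ℝ × ℝ × ℝ => p.1) hf
    ⟨(|z|, b₀, c₀), t', hzlt⟩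
  simp only at hp hm2 hmax
  have hmx : ∀ a b c, O a b c → a < 2 → a ≤ m := fun a b c h1 h2 => hmax (a, b, c) ⟨h1, h2⟩
  have hm0 : 0 < m := lt_of_lt_of_le (abs_pos.2 hz0) (hmx _ _ _ t' hzlt)
  have key : O 2 m m := by
    by_contra hc
    have : M < 4 := by
      apply h.lt4 hp hm0 hm2
      intro y z hO
      by_contra hy
      push Not at hy
      have : ∃ z', O m |y| z' := by
        rcases abs_choice y with e | e <;> rw [e]
        · exact ⟨_, hO⟩
        · exact ⟨_, h.neg2 hO⟩
      obtain ⟨z', hO'⟩ := this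
      rcases (hle _ _ _ (h.swp hO)).lt_or_eq with h1 | h1
      · exact absurd (hmx _ _ _ (h.swp hO') h1) (not_le.2 hy)
      · rw [h1] at hO'
        have := h.diag2 (h.swp hO')
        subst this
        exact hc (h.swp hO')
    linarith
  obtain ⟨α, ha0, ha1, rfl⟩ := ang_aux hm0 hm2
  obtain ⟨k, hk1, hk2, hk3⟩ := ceil_aux ha0
  have hs := h.cosseq (h.swp key) k
  have hcos : Real.cos (k * α) = - Real.cos (k * α - Real.pi) := by
    rw [Real.cos_sub_pi]; ring
  have hk : k * α = Real.pi := by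
    by_contra hne
    have hpos : 0 < k * α - Real.pi := by
      rcases hk2.lt_or_eq with h1 | h1
      · linarith
      · exact absurd h1.symm hne
    have h1 : Real.cos α < Real.cos (k * α - Real.pi) :=
      Real.cos_lt_cos_of_nonneg_of_le_pi hpos.le (by linarith [Real.pi_pos]) (by linarith)
    have h2 : Real.cos (k * α - Real.pi) < Real.cos 0 :=
      Real.cos_lt_cos_of_nonneg_of_le_pi le_rfl (by linarith [Real.pi_pos]) hpos
    rw [Real.cos_zero] at h2
    have := hmx _ _ _ (h.sgn (h.swp hs)) (by rw [hcos]; linarith)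
    rw [hcos] at this
    linarith
  have hk0 : (0 : ℝ) < k := by exact_mod_cast hk1
  have hα : α = Real.pi / k := by field_simp; linarith
  refine ⟨k, ?_, ?_⟩
  · have : (2 : ℝ) < k := by
      by_contra hc
      push Not at hc
      nlinarith
    exact_mod_cast this
  · rw [← hα]; exact h.rot key

theorem sinseq (h : FO O M) {α v : ℝ} (hs : Real.sin α ≠ 0) (t : O (2 * Real.cos α) 0 v) (j : ℕ) :
    O (2 * Real.cos α) (v * Real.sin (j * α) / Real.sin α)
      (v * Real.sin ((j + 1 : ℕ) * α) / Real.sin α) := by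
  induction j with
  | zero => simpa [hs] using t
  | succ j ih =>
    have := h.step ih
    convert this using 1
    have e1 : ((j + 1 + 1 : ℕ) : ℝ) * α = ((j + 1 : ℕ) : ℝ) * α + α := by push_cast; ring
    have e2 : (j : ℝ) * α = ((j + 1 : ℕ) : ℝ) * α - α := by push_cast; ring
    rw [e1, e2, Real.sin_add, Real.sin_sub]; ring

theorem oddseq (h : FO O M) {θ m : ℝ} (hs : Real.cos θ ≠ 0) (t : O (2 * Real.sin θ) m 0) (j : ℕ) :
    O (2 * Real.sin θ) (m * Real.cos ((2 * j + 1) * θ) / Real.cos θ)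
      (m * Real.sin ((2 * j + 2) * θ) / Real.cos θ) := by
  induction j with
  | zero =>
    have := h.vie t
    convert this using 1
    · simp [hs]
    · simp only [Nat.cast_zero, mul_zero, zero_add, Real.sin_two_mul]
      field_simp; ring
  | succ j ih =>
    have := h.neg2 (h.step (h.step ih))
    have e0 : (2 * (j : ℝ) + 1) * θ = (2 * j + 2) * θ - θ := by ring
    have e1 : (2 * ((j + 1 : ℕ) : ℝ) + 1) * θ = (2 * j + 2) * θ + θ := by push_cast; ring
    have e2 : (2 * ((j + 1 : ℕ) : ℝ) + 2) * θ = (2 * j + 2) * θ + 2 * θ := by push_cast; ring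
    have e3 := Real.sin_sq_add_cos_sq θ
    convert this using 1
    · rw [e0, e1, Real.cos_add, Real.cos_sub]; ring
    · rw [e0, e2, Real.sin_add, Real.cos_sub, Real.sin_two_mul, Real.cos_two_mul']
      generalize (2 * (j : ℝ) + 2) * θ = w
      field_simp
      linear_combination m * Real.sin w * e3

theorem classify (h : FO O M) {x y z : ℝ} (t : O x y z) :
    O 2 2 2 ∨
    (∃ n : ℕ, 3 ≤ n ∧ O (2 * Real.cos (Real.pi / n)) (2 * Real.cos (Real.pi / n)) 2) ∨
    ∃ k l : ℕ, 3 ≤ k ∧ 3 ≤ l ∧ Odd l ∧ M < 4 ∧ (k = 3 → l < 7) ∧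
      O (2 * Real.cos (Real.pi / k)) (2 * Real.sin (Real.pi / (2 * l))) 0 := by
  obtain ⟨m, ⟨y, z, hO⟩, hm, hmax⟩ := h.exists_max t
  rcases lt_or_ge m 2 with h2 | h2
  swap
  · have := (h.big hO h2).1
    subst this
    rcases h.case2 hO with h' | h'
    · exact Or.inl h'
    · exact Or.inr (Or.inl h')
  right; right
  have hM4 := h.lt4 hO hm h2 fun y' z' h' => hmax _ _ _ (h.swp h')
  obtain ⟨v, hv, hv0, hmin⟩ := h.extremal hO hm h2 hmax
  have hvm : v ≤ m := (le_abs_self v).trans (hmax _ _ _ (h.rot hv))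
  obtain ⟨α, ha0, ha1, hα⟩ := ang_aux hm h2
  obtain ⟨β, hb0, hb1, hβ⟩ := ang_aux hv0 (hvm.trans_lt h2)
  -- first angle
  have hk : ∃ k : ℕ, 3 ≤ k ∧ α = Real.pi / k := by
    obtain ⟨k, hk1, hk2, hk3⟩ := ceil_aux ha0
    have hsa : 0 < Real.sin α := Real.sin_pos_of_pos_of_lt_pi ha0 (by linarith [Real.pi_pos])
    have hs := h.sinseq hsa.ne' (v := v) (by rw [← hα]; exact h.sw2 hv) k
    have hsin : Real.sin (k * α) = - Real.sin (k * α - Real.pi) := by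
      rw [Real.sin_sub_pi]; ring
    have hk : k * α = Real.pi := by
      by_contra hne
      have hpos : 0 < k * α - Real.pi := by
        rcases hk2.lt_or_eq with h1 | h1
        · linarith
        · exact absurd h1.symm hne
      have h1 : Real.sin (k * α - Real.pi) < Real.sin α :=
        Real.sin_lt_sin_of_lt_of_le_pi_div_two (by linarith) (by linarith) (by linarith)
      have h3 : 0 < Real.sin (k * α - Real.pi) :=
        Real.sin_pos_of_pos_of_lt_pi hpos (by linarith)
      have := hmin _ _ _ (h.rot hs) (by
        rw [hsin]
        exact div_ne_zero (mul_ne_zero hv0.ne' (neg_ne_zero.2 h3.ne')) hsa.ne')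
      rw [hsin, abs_div, abs_mul, abs_neg, abs_of_pos hv0, abs_of_pos h3, abs_of_pos hsa,
        le_div_iff₀ hsa] at this
      nlinarith
    have hk0 : (0 : ℝ) < k := by exact_mod_cast hk1
    refine ⟨k, ?_, by field_simp; linarith⟩
    have : (2 : ℝ) < k := by
      by_contra hc
      push Not at hc
      nlinarith
    exact_mod_cast this
  -- second angle
  have hl : ∃ l : ℕ, 3 ≤ l ∧ Odd l ∧ v = 2 * Real.sin (Real.pi / (2 * l)) := by
    obtain ⟨θ, hθ⟩ : ∃ θ, θ = Real.pi / 2 - β := ⟨_, rfl⟩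
    have hvθ : v = 2 * Real.sin θ := by rw [hβ, hθ, Real.sin_pi_div_two_sub]
    have ht0 : 0 < θ := by linarith
    have ht1 : θ < Real.pi / 2 := by linarith
    have hc : 0 < Real.cos θ := Real.cos_pos_of_mem_Ioo ⟨by linarith, ht1⟩
    have hs := h.oddseq hc.ne' (m := m) (by rw [← hvθ]; exact h.swp hv)
    have hb1 : ∀ j : ℕ, |Real.cos ((2 * j + 1) * θ)| ≤ Real.cos θ := by
      intro j
      have := hmax _ _ _ (h.rot (hs j))
      rw [abs_div, abs_mul, abs_of_pos hm, abs_of_pos hc, div_le_iff₀ hc] at this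
      exact le_of_mul_le_mul_left this hm
    have hb2 : ∀ j : ℕ, |Real.sin ((2 * j + 2) * θ)| ≤ Real.cos θ := by
      intro j
      have := hmax _ _ _ (h.rot (h.rot (hs j)))
      rw [abs_div, abs_mul, abs_of_pos hm, abs_of_pos hc, div_le_iff₀ hc] at this
      exact le_of_mul_le_mul_left this hm
    obtain ⟨l, hl1, hl2, hl3⟩ := ceil_aux (α := 2 * θ) (by linarith)
    have hl : l * (2 * θ) = Real.pi := by
      by_contra hne
      have hpos : 0 < l * (2 * θ) - Real.pi := by
        rcases hl2.lt_or_eq with h1 | h1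
        · linarith
        · exact absurd h1.symm hne
      obtain ⟨j, rfl⟩ : ∃ j, l = j + 1 := ⟨l - 1, by omega⟩
      have := hb1 j
      push_cast at hl3 hpos
      have e : Real.cos ((2 * j + 1) * θ) = - Real.cos |(2 * j + 1) * θ - Real.pi| := by
        rw [Real.cos_abs, Real.cos_sub_pi]; ring
      rw [e, abs_neg] at this
      have h4 : |(2 * j + 1) * θ - Real.pi| < θ := by
        rw [abs_lt]; constructor <;> linarith
      have := Real.cos_lt_cos_of_nonneg_of_le_pi (abs_nonneg _) (by linarith) h4
      linarith [le_abs_self (Real.cos |(2 * j + 1) * θ - Real.pi|)]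
    have hl0 : (0 : ℝ) < l := by exact_mod_cast hl1
    have hodd : Odd l := by
      by_contra hne
      rw [Nat.not_odd_iff_even] at hne
      obtain ⟨i, hi⟩ := hne
      obtain ⟨j, rfl⟩ : ∃ j, i = j + 1 := ⟨i - 1, by omega⟩
      have := hb2 j
      have e : (2 * (j : ℝ) + 2) * θ = Real.pi / 2 := by
        rw [hi] at hl; push_cast at hl; linarith
      rw [e, Real.sin_pi_div_two, abs_one] at this
      have := Real.cos_lt_cos_of_nonneg_of_le_pi le_rfl (by linarith) ht0
      rw [Real.cos_zero] at this
      linarith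
    refine ⟨l, ?_, hodd, ?_⟩
    · have : 1 < l := by
        have : (1 : ℝ) < l := by
          by_contra hc
          push Not at hc
          nlinarith
        exact_mod_cast this
      obtain ⟨i, hi⟩ := hodd
      omega
    · rw [hvθ]; congr 2; field_simp; linarith
  obtain ⟨k, hk3, hk⟩ := hk
  obtain ⟨l, hl3, hlo, hl⟩ := hl
  refine ⟨k, l, hk3, hl3, hlo, hM4, ?_, ?_⟩
  · rintro rfl
    by_contra hl7
    push Not at hl7
    have hm1 : m = 1 := by
      rw [hα, hk]; push_cast; rw [Real.cos_pi_div_three]; norm_num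
    rw [hm1] at hv
    have hvs : v ≤ 0.45 := by
      rw [hl]
      have h7 : (7 : ℝ) ≤ l := by exact_mod_cast hl7
      have : Real.sin (Real.pi / (2 * l)) ≤ Real.pi / (2 * l) :=
        Real.sin_le (by positivity)
      have h2 : Real.pi / (2 * l) ≤ 3.15 / (2 * 7) := by
        gcongr
        linarith [Real.pi_lt_d2]
      norm_num at h2 ⊢
      linarith
    have s0 : O v 0 1 := h.rot hv
    have s2 : O v (v * v - 1) (v * (v * v - 1) - v) := by
      have := h.step (h.step (h.step s0))
      simpa using this
    have e : (v * v - 1) * (v * (v * v - 1) - v) - v = v * (1 - 3 * v ^ 2 + v ^ 4) := by ring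
    have s4 := h.rot (h.rot (h.vie (h.rot s2)))
    rw [e] at s4
    have hv2 : v ^ 2 ≤ 0.21 := by nlinarith
    have hvp : 0 < v ^ 2 := by positivity
    have p1 : 0 < 1 - 3 * v ^ 2 + v ^ 4 := by nlinarith [sq_nonneg (v ^ 2)]
    have p2 : 1 - 3 * v ^ 2 + v ^ 4 < 1 := by nlinarith
    have := hmin _ _ _ s4 (by positivity)
    rw [abs_of_pos (by positivity)] at this
    nlinarith
  · rw [← hk, ← hα, ← hl]; exact hv

end FO

inductive Orb {R : Type*} [CommRing R] (a b c : R) : R → R → R → Prop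
  | base : Orb a b c a b c
  | rot {x y z : R} : Orb a b c x y z → Orb a b c y z x
  | swp {x y z : R} : Orb a b c x y z → Orb a b c y x z
  | sgn {x y z : R} : Orb a b c x y z → Orb a b c (-x) (-y) z
  | vie {x y z : R} : Orb a b c x y z → Orb a b c x y (x * y - z)

def OrbSet {R : Type*} [CommRing R] (a b c : R) : Set (R × R × R) :=
  {p | Orb a b c p.1 p.2.1 p.2.2}

namespace Orb
variable {R S : Type*} [CommRing R] [CommRing S]

theorem map (f : R →+* S) {a b c x y z : R} (h : Orb a b c x y z) :
    Orb (f a) (f b) (f c) (f x) (f y) (f z) := by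
  induction h with
  | base => exact .base
  | rot _ ih => exact .rot ih
  | swp _ ih => exact .swp ih
  | sgn _ ih => rw [map_neg, map_neg]; exact .sgn ih
  | vie _ ih => rw [map_sub, map_mul]; exact .vie ih

theorem lift (f : R →+* S) {a b c : R} {x y z : S} (h : Orb (f a) (f b) (f c) x y z) :
    ∃ x' y' z', f x' = x ∧ f y' = y ∧ f z' = z ∧ Orb a b c x' y' z' := by
  induction h with
  | base => exact ⟨a, b, c, rfl, rfl, rfl, .base⟩
  | rot _ ih => obtain ⟨x', y', z', h1, h2, h3, h4⟩ := ih; exact ⟨y', z', x', h2, h3, h1, .rot h4⟩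
  | swp _ ih => obtain ⟨x', y', z', h1, h2, h3, h4⟩ := ih; exact ⟨y', x', z', h2, h1, h3, .swp h4⟩
  | sgn _ ih =>
    obtain ⟨x', y', z', h1, h2, h3, h4⟩ := ih
    exact ⟨-x', -y', z', by rw [map_neg, h1], by rw [map_neg, h2], h3, .sgn h4⟩
  | vie _ ih =>
    obtain ⟨x', y', z', h1, h2, h3, h4⟩ := ih
    exact ⟨x', y', x' * y' - z', h1, h2, by rw [map_sub, map_mul, h1, h2, h3], .vie h4⟩

theorem fin_map (f : R →+* S) {a b c : R} (h : (OrbSet a b c).Finite) :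
    (OrbSet (f a) (f b) (f c)).Finite := by
  refine (h.image (fun p : R × R × R => (f p.1, f p.2.1, f p.2.2))).subset ?_
  rintro ⟨x, y, z⟩ hp
  obtain ⟨x', y', z', h1, h2, h3, h4⟩ := lift f hp
  exact ⟨(x', y', z'), h4, by simp [h1, h2, h3]⟩

theorem fin_comap (f : R →+* S) (hf : Function.Injective f) {a b c : R}
    (h : (OrbSet (f a) (f b) (f c)).Finite) : (OrbSet a b c).Finite := by
  have hi : Function.Injective (fun p : R × R × R => (f p.1, f p.2.1, f p.2.2)) := by
    rintro ⟨x, y, z⟩ ⟨x', y', z'⟩ hp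
    simp only [Prod.mk.injEq] at hp ⊢
    exact ⟨hf hp.1, hf hp.2.1, hf hp.2.2⟩
  refine (h.preimage (f := fun p : R × R × R => (f p.1, f p.2.1, f p.2.2)) hi.injOn).subset ?_
  rintro ⟨x, y, z⟩ hp
  exact map f hp

theorem mono {O : R → R → R → Prop} {a b c : R} (h0 : O a b c)
    (hr : ∀ {x y z}, O x y z → O y z x) (hs : ∀ {x y z}, O x y z → O y x z)
    (hn : ∀ {x y z}, O x y z → O (-x) (-y) z) (hv : ∀ {x y z}, O x y z → O x y (x * y - z))
    {x y z : R} (h : Orb a b c x y z) : O x y z := by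
  induction h with
  | base => exact h0
  | rot _ ih => exact hr ih
  | swp _ ih => exact hs ih
  | sgn _ ih => exact hn ih
  | vie _ ih => exact hv ih

theorem toFO {a b c : ℝ} (hf : (OrbSet a b c).Finite)
    (hc : ¬ (a = 0 ∧ b = 0) ∧ ¬ (b = 0 ∧ c = 0) ∧ ¬ (a = 0 ∧ c = 0)) :
    FO (Orb a b c) (a ^ 2 + b ^ 2 + c ^ 2 - a * b * c) where
  fin := hf
  rot := .rot
  swp := .swp
  sgn := .sgn
  vie := .vie
  inv := by
    intro x y z h
    refine mono (O := fun x y z => x ^ 2 + y ^ 2 + z ^ 2 - x * y * z =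
      a ^ 2 + b ^ 2 + c ^ 2 - a * b * c) rfl ?_ ?_ ?_ ?_ h <;>
    · intro x y z h
      rw [← h]; ring
  conn := by
    intro x y z h h1 h2
    have := mono (O := fun x y z : ℝ => ¬ (x = 0 ∧ y = 0) ∧ ¬ (y = 0 ∧ z = 0) ∧ ¬ (x = 0 ∧ z = 0))
      hc (by intros; tauto) (by intros; tauto) (by intro x y z h; simpa using h) (by
        intro x y z h
        refine ⟨h.1, ?_, ?_⟩
        · rintro ⟨rfl, h'⟩
          exact h.2.1 ⟨rfl, by simpa using h'⟩
        · rintro ⟨rfl, h'⟩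
          exact h.2.2 ⟨rfl, by simpa using h'⟩) h
    exact this.2.1 ⟨h1, h2⟩

end Orb

open Polynomial in
theorem cyc_nextCoeff (n : ℕ) (hn : 0 < n) :
    (cyclotomic n ℤ).nextCoeff = - ArithmeticFunction.moebius n := by
  have key : ∀ n : ℕ, 0 < n → ∑ d ∈ n.divisors, (cyclotomic d ℤ).nextCoeff
      = if n = 1 then -1 else 0 := by
    intro n hn
    rw [← Monic.nextCoeff_prod _ _ (fun i _ => cyclotomic.monic i ℤ),
      prod_cyclotomic_eq_X_pow_sub_one hn]
    split_ifs with h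
    · subst h
      rw [pow_one, show (X - 1 : ℤ[X]) = X - C 1 by simp, nextCoeff_X_sub_C]
    · have hd : (X ^ n - 1 : ℤ[X]).natDegree = n := natDegree_X_pow_sub_C (r := (1 : ℤ))
      rw [nextCoeff_of_natDegree_pos (by rw [hd]; exact hn), hd]
      simp [coeff_X_pow, coeff_one]
      omega
  induction n using Nat.strong_induction_on with
  | _ n ih =>
    have h1 := key n hn
    have h2 : ∑ d ∈ n.divisors, ArithmeticFunction.moebius d = if n = 1 then 1 else 0 := by
      rw [← ArithmeticFunction.coe_mul_zeta_apply, ArithmeticFunction.moebius_mul_coe_zeta,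
        ArithmeticFunction.one_apply]
    rw [← Nat.insert_self_properDivisors hn.ne', Finset.sum_insert Nat.self_notMem_properDivisors] at h1 h2
    have h3 : ∑ d ∈ n.properDivisors, (cyclotomic d ℤ).nextCoeff =
        - ∑ d ∈ n.properDivisors, ArithmeticFunction.moebius d := by
      rw [← Finset.sum_neg_distrib]
      apply Finset.sum_congr rfl
      intro d hd
      exact ih d (Nat.mem_properDivisors.1 hd).2 (Nat.pos_of_mem_properDivisors hd)
    rw [h3] at h1
    split_ifs at h1 h2 <;> linarith

open Polynomial in
theorem trace_prim {K : Type*} [Field K] [NumberField K] {a : K} {n : ℕ} (hn : 0 < n)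
    (ha : IsPrimitiveRoot a n) :
    (Algebra.trace ℚ K a) * n.totient =
      Module.finrank ℚ K * (ArithmeticFunction.moebius n : ℚ) := by
  have hmin : minpoly ℚ a = cyclotomic n ℚ := (cyclotomic_eq_minpoly_rat ha hn).symm
  have hd : Module.finrank ℚ (IntermediateField.adjoin ℚ {a}) = n.totient := by
    rw [IntermediateField.adjoin.finrank (Algebra.IsIntegral.isIntegral a), hmin, natDegree_cyclotomic]
  have hnc : (cyclotomic n ℚ).nextCoeff = - (ArithmeticFunction.moebius n : ℚ) := by
    rw [← map_cyclotomic_int, nextCoeff_map (RingHom.injective_int _), cyc_nextCoeff n hn]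
    simp
  rw [trace_eq_finrank_mul_minpoly_nextCoeff, hmin, hnc,
    ← Module.finrank_mul_finrank ℚ (IntermediateField.adjoin ℚ {a}) K, hd]
  push_cast; ring

theorem trace_ge {K : Type*} [Field K] [NumberField K] {x : K} (hx : IsIntegral ℤ x)
    (hp : ∀ σ : K →ₐ[ℚ] ℂ, ∃ r : ℝ, 0 < r ∧ σ x = r) :
    (Module.finrank ℚ K : ℚ) ≤ Algebra.trace ℚ K x := by
  choose r hr0 hr using hp
  have hN := Algebra.norm_eq_prod_embeddings ℚ ℂ x
  have hT := trace_eq_sum_embeddings (K := ℚ) (L := K) ℂ (x := x)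
  simp only [hr, eq_ratCast] at hN hT
  have hN' : ((Algebra.norm ℚ x : ℚ) : ℝ) = ∏ σ : K →ₐ[ℚ] ℂ, r σ := by exact_mod_cast hN
  have hT' : ((Algebra.trace ℚ K x : ℚ) : ℝ) = ∑ σ : K →ₐ[ℚ] ℂ, r σ := by exact_mod_cast hT
  obtain ⟨z, hz⟩ := IsIntegrallyClosed.isIntegral_iff.1 (Algebra.isIntegral_norm ℚ hx)
  have hpos : (0 : ℝ) < ∏ σ : K →ₐ[ℚ] ℂ, r σ := Finset.prod_pos (fun σ _ => hr0 σ)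
  have h1 : (1 : ℝ) ≤ ∏ σ : K →ₐ[ℚ] ℂ, r σ := by
    rw [← hN', ← hz] at hpos ⊢
    simp only [eq_intCast, Rat.cast_intCast] at hpos ⊢
    have : 0 < z := by exact_mod_cast hpos
    exact_mod_cast this
  have h2 : 0 ≤ ∑ σ : K →ₐ[ℚ] ℂ, Real.log (r σ) := by
    rw [← Real.log_prod (fun σ _ => (hr0 σ).ne')]
    exact Real.log_nonneg h1
  have h3 : ∑ σ : K →ₐ[ℚ] ℂ, Real.log (r σ) ≤ ∑ σ : K →ₐ[ℚ] ℂ, (r σ - 1) :=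
    Finset.sum_le_sum (fun σ _ => Real.log_le_sub_one_of_pos (hr0 σ))
  rw [Finset.sum_sub_distrib, ← hT'] at h3
  have hc : Fintype.card (K →ₐ[ℚ] ℂ) = Module.finrank ℚ K := AlgHom.card ℚ K ℂ
  have h4 : ((Module.finrank ℚ K : ℚ) : ℝ) ≤ ((Algebra.trace ℚ K x : ℚ) : ℝ) := by
    simp [hc] at h3
    push_cast
    linarith
  exact_mod_cast h4

theorem tot_lower (k : ℕ) (hk : 5 ≤ k) (h6 : k ≠ 6) : 4 ≤ k.totient := by
  by_contra hlt
  have hlt : k.totient < 4 := by omega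
  have hpos : 0 < k := by omega
  -- prime divisors are 2, 3
  have hpd : ∀ p, p.Prime → p ∣ k → p ≤ 3 := by
    intro p hp hpk
    have h1 : p.totient ≤ k.totient := Nat.le_of_dvd (Nat.totient_pos.2 hpos) (Nat.totient_dvd_of_dvd hpk)
    rw [Nat.totient_prime hp] at h1
    by_contra h
    have : p = 4 := by omega
    subst this
    revert hp; norm_num
  have hd8 : ¬ 8 ∣ k := fun h => by
    have := Nat.le_of_dvd (Nat.totient_pos.2 hpos) (Nat.totient_dvd_of_dvd h)
    have h8 : Nat.totient 8 = 4 := by decide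
    omega
  have hd9 : ¬ 9 ∣ k := fun h => by
    have := Nat.le_of_dvd (Nat.totient_pos.2 hpos) (Nat.totient_dvd_of_dvd h)
    have h8 : Nat.totient 9 = 6 := by decide
    omega
  have hd12 : ¬ 12 ∣ k := fun h => by
    have := Nat.le_of_dvd (Nat.totient_pos.2 hpos) (Nat.totient_dvd_of_dvd h)
    have h8 : Nat.totient 12 = 4 := by decide
    omega
  have hdvd : k ∣ 36 := by
    rw [← Nat.factorization_le_iff_dvd hpos.ne' (by norm_num)]
    intro p
    by_cases hp : p.Prime
    · by_cases hpk : p ∣ k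
      · have h3 := hpd p hp hpk
        have h2 := hp.two_le
        interval_cases p
        · have : ¬ 2 ^ 3 ∣ k := by norm_num; exact hd8
          have h2' : ¬ 3 ≤ k.factorization 2 := fun h => this ((Nat.Prime.pow_dvd_iff_le_factorization hp hpos.ne').2 h)
          have : 2 ≤ (36 : ℕ).factorization 2 :=
            (Nat.Prime.pow_dvd_iff_le_factorization hp (by norm_num)).1 (by norm_num)
          omega
        · have : ¬ 3 ^ 2 ∣ k := by norm_num; exact hd9
          have h2' : ¬ 2 ≤ k.factorization 3 := fun h => this ((Nat.Prime.pow_dvd_iff_le_factorization hp hpos.ne').2 h)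
          have : 2 ≤ (36 : ℕ).factorization 3 :=
            (Nat.Prime.pow_dvd_iff_le_factorization hp (by norm_num)).1 (by norm_num)
          omega
      · rw [Nat.factorization_eq_zero_of_not_dvd hpk]; exact Nat.zero_le _
    · rw [Nat.factorization_eq_zero_of_not_prime _ hp]; exact Nat.zero_le _
  have hle := Nat.le_of_dvd (by norm_num) hdvd
  interval_cases k <;> omega

theorem tot4 (k : ℕ) (ht : k.totient = 4) (hm : ArithmeticFunction.moebius k = -1) : k = 5 := by
  have hpos : 0 < k := by
    rcases Nat.eq_zero_or_pos k with rfl | h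
    · simp at ht
    · exact h
  have hsq : Squarefree k := by
    rw [← ArithmeticFunction.moebius_ne_zero_iff_squarefree, hm]; norm_num
  have hpd : ∀ p, p.Prime → p ∣ k → p ∣ 30 := by
    intro p hp hpk
    have h1 : p.totient ≤ k.totient := Nat.le_of_dvd (Nat.totient_pos.2 hpos) (Nat.totient_dvd_of_dvd hpk)
    rw [Nat.totient_prime hp] at h1
    have h2 := hp.two_le
    have h3 : p ≤ 5 := by omega
    interval_cases p
    · norm_num
    · norm_num
    · revert hp; norm_num
    · norm_num
  have hdvd : k ∣ 30 := by
    rw [← Nat.factorization_le_iff_dvd hpos.ne' (by norm_num)]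
    intro p
    by_cases hp : p.Prime
    · by_cases hpk : p ∣ k
      · have h1 := hsq.natFactorization_le_one p
        have := (hp.dvd_iff_one_le_factorization (by norm_num)).1 (hpd p hp hpk)
        omega
      · rw [Nat.factorization_eq_zero_of_not_dvd hpk]; exact Nat.zero_le _
    · rw [Nat.factorization_eq_zero_of_not_prime _ hp]; exact Nat.zero_le _
  have hle := Nat.le_of_dvd (by norm_num) hdvd
  by_cases h10 : k = 10
  · subst h10
    exfalso
    have : ArithmeticFunction.moebius 10 = 1 := by
      rw [show (10:ℕ) = 2 * 5 by norm_num, ArithmeticFunction.isMultiplicative_moebius.map_mul_of_coprime (by norm_num),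
        ArithmeticFunction.moebius_apply_prime (by norm_num),
        ArithmeticFunction.moebius_apply_prime (by norm_num)]
      norm_num
    omega
  · have h30 : ∀ k ≤ 30, k ∣ 30 → k.totient = 4 → k = 5 ∨ k = 10 := by decide
    rcases h30 k hle hdvd ht with h | h
    · exact h
    · exact absurd h h10

theorem moeb_ge (k : ℕ) : (-1 : ℤ) ≤ ArithmeticFunction.moebius k :=
  neg_le_of_abs_le ArithmeticFunction.abs_moebius_le_one

theorem arith_kill (k l : ℕ) (hk : 4 ≤ k) (hl : 5 ≤ l) (hodd : Odd l)
    (h : (1 : ℚ) ≤ -2 * (ArithmeticFunction.moebius k : ℚ) / k.totient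
      - 2 * (ArithmeticFunction.moebius l : ℚ) / l.totient) : k = 5 ∧ l = 5 := by
  have bd : ∀ j : ℕ, 4 ≤ j → -2 * (ArithmeticFunction.moebius j : ℚ) / j.totient ≤ 1/2 ∧
      (1/2 ≤ -2 * (ArithmeticFunction.moebius j : ℚ) / j.totient → j = 5) := by
    intro j hj
    have hm : (-1 : ℚ) ≤ ArithmeticFunction.moebius j := by exact_mod_cast moeb_ge j
    by_cases h46 : j = 4 ∨ j = 6
    · have hm0 : (0 : ℚ) ≤ ArithmeticFunction.moebius j := by
        rcases h46 with rfl | rfl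
        · rw [ArithmeticFunction.moebius_eq_zero_of_not_squarefree (by decide)]; simp
        · rw [show (6:ℕ) = 2 * 3 by norm_num, ArithmeticFunction.isMultiplicative_moebius.map_mul_of_coprime (by norm_num),
            ArithmeticFunction.moebius_apply_prime (by norm_num),
            ArithmeticFunction.moebius_apply_prime (by norm_num)]
          norm_num
      have : -2 * (ArithmeticFunction.moebius j : ℚ) / j.totient ≤ 0 :=
        div_nonpos_of_nonpos_of_nonneg (by linarith) (by positivity)
      exact ⟨by linarith, fun h => by linarith⟩
    · push Not at h46
      have ht := tot_lower j (by omega) h46.2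
      have ht' : (4 : ℚ) ≤ j.totient := by exact_mod_cast ht
      have htp : (0 : ℚ) < j.totient := by linarith
      constructor
      · rw [div_le_iff₀ htp]; linarith
      · intro h
        rw [le_div_iff₀ htp] at h
        apply tot4
        · have : (j.totient : ℚ) ≤ 4 := by linarith
          have : j.totient ≤ 4 := by exact_mod_cast this
          omega
        · have : (ArithmeticFunction.moebius j : ℚ) = -1 := by linarith
          exact_mod_cast this
  have h1 := bd k hk
  have h2 := bd l (by omega)
  have e : -2 * (ArithmeticFunction.moebius l : ℚ) / l.totient = - (2 * (ArithmeticFunction.moebius l : ℚ) / l.totient) := by ring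
  rw [e] at h2
  exact ⟨h1.2 (by linarith), h2.2 (by linarith)⟩

theorem add_inv_unit (w : ℂ) (hw : ‖w‖ = 1) : w + w⁻¹ = ((2 * w.re : ℝ) : ℂ) := by
  rw [Complex.inv_def, Complex.normSq_eq_norm_sq, hw]
  apply Complex.ext <;> simp
  ring

theorem exp_re_aux (N j : ℕ) : ((Complex.exp (2 * Real.pi * Complex.I / N)) ^ j).re =
    Real.cos (2 * Real.pi * j / N) := by
  rw [← Complex.exp_nat_mul]
  have : (j : ℂ) * (2 * Real.pi * Complex.I / N) = ((2 * Real.pi * j / N : ℝ) : ℂ) * Complex.I := by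
    push_cast; ring
  rw [this, Complex.exp_ofReal_mul_I_re]

theorem FO.kill_aux {O : ℝ → ℝ → ℝ → Prop} {M : ℝ} (hO : FO O M) (hM : M < 4) (k l N : ℕ)
    (hNdef : N = 2 * k * l) [NeZero N] (K : Type) [Field K] [NumberField K]
    [IsCyclotomicExtension {N} ℚ K]
    (hk : 4 ≤ k) (hl : 5 ≤ l) (hodd : Odd l)
    (h : O (2 * Real.cos (Real.pi / k)) (2 * Real.sin (Real.pi / (2 * l))) 0) : k = 5 ∧ l = 5 := by
  obtain ⟨q, hq⟩ := hodd
  have hN : 0 < N := NeZero.pos N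
  set ζ : K := IsCyclotomicExtension.zeta N ℚ K with hζd
  have hζ : IsPrimitiveRoot ζ N := IsCyclotomicExtension.zeta_spec N ℚ K
  have hζ0 : ζ ≠ 0 := hζ.ne_zero hN.ne'
  have hirr := Polynomial.cyclotomic.irreducible_rat hN
  set mK : K := ζ ^ l + (ζ ^ l)⁻¹ with hmK
  set vK : K := ζ ^ (q * k) + (ζ ^ (q * k))⁻¹ with hvK
  -- the base embedding
  have hw : IsPrimitiveRoot (Complex.exp (2 * Real.pi * Complex.I / N)) N :=
    Complex.isPrimitiveRoot_exp N hN.ne'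
  let e := hζ.embeddingsEquivPrimitiveRoots ℂ hirr
  let σ0 : K →ₐ[ℚ] ℂ := e.symm ⟨_, (mem_primitiveRoots hN).2 hw⟩
  have hσ0 : σ0 ζ = Complex.exp (2 * Real.pi * Complex.I / N) := by
    have := hζ.embeddingsEquivPrimitiveRoots_apply_coe ℂ hirr σ0
    rw [← this]
    change ((e (e.symm _) : primitiveRoots N ℂ) : ℂ) = _
    rw [Equiv.apply_symm_apply]
  have hnorm : ∀ σ : K →ₐ[ℚ] ℂ, ‖σ ζ‖ = 1 := fun σ =>
    (hζ.map_of_injective σ.toRingHom.injective).norm'_eq_one hN.ne'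
  have hre : ∀ (σ : K →ₐ[ℚ] ℂ) (j : ℕ), σ (ζ ^ j + (ζ ^ j)⁻¹) = ((2 * ((σ ζ) ^ j).re : ℝ) : ℂ) := by
    intro σ j
    rw [map_add, map_inv₀, map_pow]
    exact add_inv_unit _ (by rw [norm_pow, hnorm, one_pow])
  have hkR : (0 : ℝ) < k := by exact_mod_cast (by omega : 0 < k)
  have hlR : (0 : ℝ) < l := by exact_mod_cast (by omega : 0 < l)
  have hm0 : σ0 mK = ((2 * Real.cos (Real.pi / k) : ℝ) : ℂ) := by
    rw [hmK, hre, hσ0, exp_re_aux]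
    congr 3
    rw [hNdef]; push_cast; field_simp
  have hv0 : σ0 vK = ((2 * Real.sin (Real.pi / (2 * l)) : ℝ) : ℂ) := by
    rw [hvK, hre, hσ0, exp_re_aux, ← Real.cos_pi_div_two_sub]
    congr 3
    have : (q : ℝ) = (l - 1) / 2 := by rw [hq]; push_cast; ring
    rw [hNdef]; push_cast; rw [this]; field_simp
  -- positivity of base values
  have hmpos : 0 < Real.cos (Real.pi / k) := by
    apply Real.cos_pos_of_mem_Ioo
    have h4 : (4 : ℝ) ≤ k := by exact_mod_cast hk
    have : Real.pi / k < Real.pi / 2 := by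
      apply div_lt_div_of_pos_left Real.pi_pos (by norm_num) (by linarith)
    exact ⟨by have := div_pos Real.pi_pos hkR; linarith [Real.pi_pos], this⟩
  have hvpos : 0 < Real.sin (Real.pi / (2 * l)) := by
    apply Real.sin_pos_of_pos_of_lt_pi (by have := Real.pi_pos; positivity)
    apply div_lt_self Real.pi_pos
    have h4 : (5 : ℝ) ≤ l := by exact_mod_cast hl
    linarith
  have hmK0 : mK ≠ 0 := by
    intro h0
    rw [h0, map_zero] at hm0
    have : (0 : ℝ) = 2 * Real.cos (Real.pi / k) := by exact_mod_cast hm0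
    linarith
  have hvK0 : vK ≠ 0 := by
    intro h0
    rw [h0, map_zero] at hv0
    have : (0 : ℝ) = 2 * Real.sin (Real.pi / (2 * l)) := by exact_mod_cast hv0
    linarith
  set xK : K := 4 - mK ^ 2 - vK ^ 2 with hxK
  have hx0 : xK ≠ 0 := by
    intro h0
    have h1 : σ0 xK = ((4 - M : ℝ) : ℂ) := by
      rw [hxK, map_sub, map_sub, map_pow, map_pow, hm0, hv0, ← hO.inv h, map_ofNat]
      push_cast; ring
    rw [h0, map_zero] at h1
    have : (0 : ℝ) = 4 - M := by exact_mod_cast h1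
    linarith
  -- finite orbit in K
  have hfin0 : (OrbSet (2 * Real.cos (Real.pi / k)) (2 * Real.sin (Real.pi / (2 * l))) (0 : ℝ)).Finite := by
    refine hO.fin.subset ?_
    rintro ⟨x, y, z⟩ hp
    exact Orb.mono h hO.rot hO.swp hO.sgn hO.vie hp
  have hfinK : (OrbSet mK vK 0).Finite := by
    apply Orb.fin_comap σ0.toRingHom σ0.toRingHom.injective
    have := Orb.fin_map Complex.ofRealHom hfin0
    have e1 : σ0.toRingHom mK = Complex.ofRealHom (2 * Real.cos (Real.pi / k)) := hm0
    have e2 : σ0.toRingHom vK = Complex.ofRealHom (2 * Real.sin (Real.pi / (2 * l))) := hv0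
    rw [e1, e2, map_zero]
    rwa [map_zero] at this
  have hpos : ∀ σ : K →ₐ[ℚ] ℂ, ∃ r : ℝ, 0 < r ∧ σ xK = r := by
    intro σ
    have hm1 := hre σ l
    have hv1 := hre σ (q * k)
    rw [← hmK] at hm1
    rw [← hvK] at hv1
    set a : ℝ := 2 * ((σ ζ) ^ l).re with ha
    set b : ℝ := 2 * ((σ ζ) ^ (q * k)).re with hb
    have hfinC := Orb.fin_map σ.toRingHom hfinK
    have e1 : σ.toRingHom mK = Complex.ofRealHom a := hm1
    have e2 : σ.toRingHom vK = Complex.ofRealHom b := hv1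
    rw [e1, e2, map_zero, ← map_zero Complex.ofRealHom] at hfinC
    have hfinR := Orb.fin_comap Complex.ofRealHom Complex.ofRealHom.injective hfinC
    have ha0 : a ≠ 0 := by
      intro h0
      rw [h0] at hm1
      exact hmK0 (σ.toRingHom.injective (by rw [map_zero]; simpa using hm1))
    have hb0 : b ≠ 0 := by
      intro h0
      rw [h0] at hv1
      exact hvK0 (σ.toRingHom.injective (by rw [map_zero]; simpa using hv1))
    have hFO := Orb.toFO hfinR ⟨fun h => ha0 h.1, fun h => hb0 h.1, fun h => ha0 h.1⟩
    have h4 := hFO.le4 .base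
    have hσx : σ xK = ((4 - a ^ 2 - b ^ 2 : ℝ) : ℂ) := by
      rw [hxK, map_sub, map_sub, map_pow, map_pow, hm1, hv1, map_ofNat]
      push_cast; ring
    refine ⟨4 - a ^ 2 - b ^ 2, ?_, hσx⟩
    have hne : 4 - a ^ 2 - b ^ 2 ≠ 0 := by
      intro h0
      rw [h0] at hσx
      exact hx0 (σ.toRingHom.injective (by rw [map_zero]; simpa using hσx))
    have : 0 ≤ 4 - a ^ 2 - b ^ 2 := by
      have : a ^ 2 + b ^ 2 + 0 ^ 2 - a * b * 0 ≤ 4 := h4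
      linarith
    exact lt_of_le_of_ne this hne.symm
  have hint : IsIntegral ℤ ζ := hζ.isIntegral hN
  have hinti : IsIntegral ℤ ζ⁻¹ := hζ.inv.isIntegral hN
  have hintm : IsIntegral ℤ mK := by rw [hmK, ← inv_pow]; exact (hint.pow _).add (hinti.pow _)
  have hintv : IsIntegral ℤ vK := by rw [hvK, ← inv_pow]; exact (hint.pow _).add (hinti.pow _)
  have hintx : IsIntegral ℤ xK := by
    refine ((?_ : IsIntegral ℤ (4 : K)).sub (hintm.pow 2)).sub (hintv.pow 2)
    have := isIntegral_algebraMap (R := ℤ) (A := K) (x := 4)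
    simpa using this
  have htr := trace_ge hintx hpos
  -- trace computation
  have hpa : IsPrimitiveRoot (ζ ^ (2 * l)) k :=
    hζ.pow hN (by rw [hNdef]; ring)
  have hpb0 : IsPrimitiveRoot (ζ ^ (2 * k)) l :=
    hζ.pow hN (by rw [hNdef])
  have hcop : Nat.Coprime q l := by
    rw [hq]; simp
  have hpb : IsPrimitiveRoot ((ζ ^ (2 * k)) ^ q) l := hpb0.pow_of_coprime q hcop
  have hxe : xK = - (ζ ^ (2 * l) + (ζ ^ (2 * l))⁻¹) - ((ζ ^ (2 * k)) ^ q + ((ζ ^ (2 * k)) ^ q)⁻¹) := by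
    rw [hxK, hmK, hvK]
    have e1 : ζ ^ (2 * l) = (ζ ^ l) ^ 2 := by rw [← pow_mul]; ring_nf
    have e2 : (ζ ^ (2 * k)) ^ q = (ζ ^ (q * k)) ^ 2 := by rw [← pow_mul, ← pow_mul]; ring_nf
    rw [e1, e2]
    have h1 : ζ ^ l ≠ 0 := pow_ne_zero _ hζ0
    have h2 : ζ ^ (q * k) ≠ 0 := pow_ne_zero _ hζ0
    generalize ζ ^ l = A at *
    generalize ζ ^ (q * k) = B at *
    field_simp
    ring
  have hkφ : (0 : ℚ) < k.totient := by exact_mod_cast Nat.totient_pos.2 (by omega)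
  have hlφ : (0 : ℚ) < l.totient := by exact_mod_cast Nat.totient_pos.2 (by omega)
  have hd : (0 : ℚ) < Module.finrank ℚ K := by exact_mod_cast Module.finrank_pos
  have T : ∀ (n : ℕ) (a : K), 0 < n → IsPrimitiveRoot a n → Algebra.trace ℚ K a =
      Module.finrank ℚ K * ((ArithmeticFunction.moebius n : ℚ) / n.totient) := by
    intro n a hn ha
    have hφ : (0 : ℚ) < n.totient := by exact_mod_cast Nat.totient_pos.2 hn
    have := trace_prim hn ha
    rw [← mul_div_assoc, eq_div_iff hφ.ne']
    exact this
  rw [hxe, map_sub, map_neg, map_add, map_add, T k _ (by omega) hpa, T k _ (by omega) hpa.inv,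
    T l _ (by omega) hpb, T l _ (by omega) hpb.inv] at htr
  apply arith_kill k l hk hl ⟨q, hq⟩
  have : (Module.finrank ℚ K : ℚ) * 1 ≤ Module.finrank ℚ K *
      (-2 * (ArithmeticFunction.moebius k : ℚ) / k.totient
      - 2 * (ArithmeticFunction.moebius l : ℚ) / l.totient) := by
    refine le_trans (le_of_eq (mul_one _)) (htr.trans (le_of_eq ?_))
    ring
  exact le_of_mul_le_mul_left this hd

theorem FO.kill {O : ℝ → ℝ → ℝ → Prop} {M : ℝ} (hO : FO O M) (hM : M < 4) (k l : ℕ)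
    (hk : 4 ≤ k) (hl : 5 ≤ l) (hodd : Odd l)
    (h : O (2 * Real.cos (Real.pi / k)) (2 * Real.sin (Real.pi / (2 * l))) 0) : k = 5 ∧ l = 5 := by
  obtain ⟨N, hN⟩ : ∃ N, N = 2 * k * l := ⟨_, rfl⟩
  have : NeZero N := ⟨by rw [hN]; positivity⟩
  have : NeZero (N : ℚ) := ⟨by exact_mod_cast (NeZero.ne N)⟩
  have : IsCyclotomicExtension {N} ℚ (CyclotomicField N ℚ) :=
    CyclotomicField.isCyclotomicExtension N ℚ
  have : NumberField (CyclotomicField N ℚ) := IsCyclotomicExtension.numberField {N} ℚ _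
  exact FO.kill_aux hO hM k l N hN (CyclotomicField N ℚ) hk hl hodd h

theorem FO.final {O : ℝ → ℝ → ℝ → Prop} {M x y z : ℝ} (h : FO O M) (t : O x y z) :
    O 2 2 2 ∨ (∃ n : ℕ, 3 ≤ n ∧ O (2 * Real.cos (Real.pi / n)) (2 * Real.cos (Real.pi / n)) 2) ∨
    O 1 1 0 ∨ O 1 (Real.sqrt 2) 0 ∨ O 1 (2 * Real.cos (Real.pi / 5)) 0 ∨
    O (2 * Real.cos (Real.pi / 5)) (2 * Real.cos (2 * Real.pi / 5)) 0 ∨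
    O 1 (2 * Real.cos (2 * Real.pi / 5)) 0 := by
  have hs5 : Real.sin (Real.pi / (2 * (5 : ℕ))) = Real.cos (2 * Real.pi / 5) := by
    rw [← Real.cos_pi_div_two_sub]; congr 1; push_cast; ring
  rcases h.classify t with h1 | h1 | ⟨k, l, hk, hl, hodd, hM, h37, hO⟩
  · exact Or.inl h1
  · exact Or.inr (Or.inl h1)
  right; right
  by_cases hl3 : l = 3
  · subst hl3
    have hs : Real.sin (Real.pi / (2 * (3 : ℕ))) = 1 / 2 := by
      rw [← Real.sin_pi_div_six]; congr 1; push_cast; ring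
    rw [hs, show (2 : ℝ) * (1 / 2) = 1 by norm_num] at hO
    have hk6 : k < 6 := by
      by_contra hge
      have hge : 6 ≤ k := by omega
      have hge' : (6 : ℝ) ≤ k := by exact_mod_cast hge
      have hc : Real.cos (Real.pi / 6) ≤ Real.cos (Real.pi / k) := by
        apply Real.cos_le_cos_of_nonneg_of_le_pi
        · have := Real.pi_pos; positivity
        · linarith [Real.pi_pos]
        · exact div_le_div_of_nonneg_left Real.pi_pos.le (by norm_num) hge'
      rw [Real.cos_pi_div_six] at hc
      have hi := h.inv hO
      have h3 : Real.sqrt 3 ^ 2 = 3 := Real.sq_sqrt (by norm_num)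
      have := Real.sqrt_nonneg 3
      nlinarith
    have hO' := h.swp hO
    interval_cases k
    · left
      simpa [Real.cos_pi_div_three] using hO'
    · right; left
      rw [show ((4 : ℕ) : ℝ) = 4 by norm_num, Real.cos_pi_div_four,
        show 2 * (Real.sqrt 2 / 2) = Real.sqrt 2 by ring] at hO'
      exact hO'
    · right; right; left
      simpa using hO'
  · have hl5 : 5 ≤ l := by
      obtain ⟨q, hq⟩ := hodd
      omega
    by_cases hk3 : k = 3
    · subst hk3
      have : l = 5 := by
        have := h37 rfl
        obtain ⟨q, hq⟩ := hodd
        omega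
      subst this
      rw [hs5, show ((3 : ℕ) : ℝ) = 3 by norm_num, Real.cos_pi_div_three] at hO
      right; right; right; right
      simpa using hO
    · obtain ⟨rfl, rfl⟩ := h.kill hM k l (by omega) hl5 hodd hO
      rw [hs5] at hO
      right; right; right; left
      simpa using hO

def TM (x y z : ℝ) : Matrix (Fin 3) (Fin 3) ℝ := !![0, x, -z; -x, 0, y; z, -y, 0]

theorem TM_of_skew (B : Matrix (Fin 3) (Fin 3) ℝ) (hB : Bᵀ = -B) :
    B = TM (B 0 1) (B 1 2) (B 2 0) := by
  have h : ∀ i j, B j i = - B i j := fun i j => by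
    have := congrFun (congrFun hB i) j
    simpa using this
  have h0 : ∀ i, B i i = 0 := fun i => by have := h i i; linarith
  ext i j
  fin_cases i <;> fin_cases j <;> simp [TM, h0]
  · exact h 2 0
  · exact h 0 1
  · exact h 1 2

theorem TM_mut0 (x y z : ℝ) :
    mutate 0 (TM x y z) = TM (-x) (y - (|x| * z + x * |z|) / 2) (-z) := by
  ext i j
  fin_cases i <;> fin_cases j <;> simp [TM, mutate] <;> ring

theorem TM_mut1 (x y z : ℝ) :
    mutate 1 (TM x y z) = TM (-x) (-y) (z - (|x| * y + x * |y|) / 2) := by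
  ext i j
  fin_cases i <;> fin_cases j <;> simp [TM, mutate] <;> ring

theorem TM_mut2 (x y z : ℝ) :
    mutate 2 (TM x y z) = TM (x - (|y| * z + y * |z|) / 2) (-y) (-z) := by
  ext i j
  fin_cases i <;> fin_cases j <;> simp [TM, mutate] <;> ring

theorem TM_rot (x y z : ℝ) :
    (Matrix.of fun i j => TM x y z (finRotate 3 i) (finRotate 3 j)) = TM y z x := by
  ext i j
  fin_cases i <;> fin_cases j <;> simp [TM]

theorem TM_swap (x y z : ℝ) :
    (Matrix.of fun i j => TM x y z (Equiv.swap (0 : Fin 3) 2 i) (Equiv.swap (0 : Fin 3) 2 j)) =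
      TM (-y) (-x) (-z) := by
  ext i j
  fin_cases i <;> fin_cases j <;> simp [TM, Equiv.swap_apply_def]

theorem perm_cases (P : Equiv.Perm (Fin 3) → Prop) (h1 : P 1)
    (hr : ∀ σ, P σ → P (σ * finRotate 3)) (hs : ∀ σ, P σ → P (σ * Equiv.swap 0 2))
    (σ : Equiv.Perm (Fin 3)) : P σ := by
  have : ∀ σ : Equiv.Perm (Fin 3), σ = 1 ∨ σ = 1 * finRotate 3 ∨ σ = 1 * finRotate 3 * finRotate 3 ∨
    σ = 1 * Equiv.swap 0 2 ∨ σ = 1 * finRotate 3 * Equiv.swap 0 2 ∨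
    σ = 1 * finRotate 3 * finRotate 3 * Equiv.swap 0 2 := by decide
  rcases this σ with h | h | h | h | h | h <;> rw [h]
  · exact h1
  · exact hr _ h1
  · exact hr _ (hr _ h1)
  · exact hs _ h1
  · exact hs _ (hr _ h1)
  · exact hs _ (hr _ (hr _ h1))

/-- closure principle -/
theorem step_closed (G : ℝ → ℝ → ℝ → Prop)
    (hr : ∀ x y z, G x y z → G y z x) (hs : ∀ x y z, G x y z → G (-y) (-x) (-z))
    (hm : ∀ x y z, G x y z → G (-x) (-y) (z - (|x| * y + x * |y|) / 2))
    {x y z : ℝ} {B' : Matrix (Fin 3) (Fin 3) ℝ} (h : G x y z) (hst : MutationStep (TM x y z) B') :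
    ∃ x' y' z', B' = TM x' y' z' ∧ G x' y' z' := by
  rcases hst with ⟨k, rfl⟩ | ⟨σ, rfl⟩
  · fin_cases k
    · refine ⟨_, _, _, TM_mut0 x y z, ?_⟩
      have h1 := hr _ _ _ (hm _ _ _ (hr _ _ _ (hr _ _ _ h)))
      convert h1 using 1
      ring
    · exact ⟨_, _, _, TM_mut1 x y z, hm _ _ _ h⟩
    · refine ⟨_, _, _, TM_mut2 x y z, ?_⟩
      have h1 := hr _ _ _ (hr _ _ _ (hm _ _ _ (hr _ _ _ h)))
      exact h1
  · refine perm_cases (fun σ => ∃ x' y' z', (Matrix.of fun i j => TM x y z (σ i) (σ j)) = TM x' y' z'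
      ∧ G x' y' z') ⟨x, y, z, by ext i j; simp, h⟩ ?_ ?_ σ
    · rintro σ ⟨a, b, c, h1, h2⟩
      refine ⟨b, c, a, ?_, hr _ _ _ h2⟩
      rw [← TM_rot a b c, ← h1]
      ext i j; simp
    · rintro σ ⟨a, b, c, h1, h2⟩
      refine ⟨-b, -a, -c, ?_, hs _ _ _ h2⟩
      rw [← TM_swap a b c, ← h1]
      ext i j; simp

theorem equiv_closed (G : ℝ → ℝ → ℝ → Prop)
    (hr : ∀ x y z, G x y z → G y z x) (hs : ∀ x y z, G x y z → G (-y) (-x) (-z))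
    (hm : ∀ x y z, G x y z → G (-x) (-y) (z - (|x| * y + x * |y|) / 2))
    {x y z : ℝ} {B' : Matrix (Fin 3) (Fin 3) ℝ} (h : G x y z) (hst : MutationEquiv (TM x y z) B') :
    ∃ x' y' z', B' = TM x' y' z' ∧ G x' y' z' := by
  induction hst with
  | refl => exact ⟨_, _, _, rfl, h⟩
  | tail _ h2 ih =>
    obtain ⟨a, b, c, rfl, hG⟩ := ih
    exact step_closed G hr hs hm hG h2

theorem mutate_invol (x y z : ℝ) (k : Fin 3) : mutate k (mutate k (TM x y z)) = TM x y z := by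
  fin_cases k
  · simp only [Fin.zero_eta, TM_mut0, abs_neg]
    congr 1 <;> ring
  · simp only [Fin.mk_one, TM_mut1, abs_neg]
    congr 1 <;> ring
  · simp only [Fin.reduceFinMk, TM_mut2, abs_neg]
    congr 1 <;> ring

theorem step_symm {x y z : ℝ} {B' : Matrix (Fin 3) (Fin 3) ℝ} (h : MutationStep (TM x y z) B') :
    MutationStep B' (TM x y z) := by
  rcases h with ⟨k, rfl⟩ | ⟨σ, rfl⟩
  · exact Or.inl ⟨k, (mutate_invol x y z k).symm⟩
  · exact Or.inr ⟨σ⁻¹, by ext i j; simp⟩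

theorem equiv_symm {x y z : ℝ} {B' : Matrix (Fin 3) (Fin 3) ℝ} (h : MutationEquiv (TM x y z) B') :
    MutationEquiv B' (TM x y z) ∧ ∃ x' y' z', B' = TM x' y' z' := by
  induction h with
  | refl => exact ⟨.refl, _, _, _, rfl⟩
  | tail _ h2 ih =>
    obtain ⟨h3, a, b, c, rfl⟩ := ih
    obtain ⟨a', b', c', h4, -⟩ := step_closed (fun _ _ _ => True) (by simp) (by simp) (by simp) trivial h2
    exact ⟨(Relation.ReflTransGen.single (step_symm h2)).trans h3, a', b', c', h4⟩

def Cyc (a b c : ℝ) : Prop := (0 < a ∧ 0 < b ∧ 0 < c) ∨ (a < 0 ∧ b < 0 ∧ c < 0)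

/-- reachable triples -/
def Rch (B : Matrix (Fin 3) (Fin 3) ℝ) (x y z : ℝ) : Prop :=
  ∃ a b c, MutationEquiv B (TM a b c) ∧ |a| = |x| ∧ |b| = |y| ∧ |c| = |z| ∧
    (Cyc a b c ↔ 0 < x * y * z)

theorem eq_mut0 {B : Matrix (Fin 3) (Fin 3) ℝ} {a b c : ℝ} (h : MutationEquiv B (TM a b c)) :
    MutationEquiv B (TM (-a) (b - (|a| * c + a * |c|) / 2) (-c)) :=
  h.tail (Or.inl ⟨0, (TM_mut0 a b c).symm⟩)
theorem eq_mut1 {B : Matrix (Fin 3) (Fin 3) ℝ} {a b c : ℝ} (h : MutationEquiv B (TM a b c)) :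
    MutationEquiv B (TM (-a) (-b) (c - (|a| * b + a * |b|) / 2)) :=
  h.tail (Or.inl ⟨1, (TM_mut1 a b c).symm⟩)
theorem eq_mut2 {B : Matrix (Fin 3) (Fin 3) ℝ} {a b c : ℝ} (h : MutationEquiv B (TM a b c)) :
    MutationEquiv B (TM (a - (|b| * c + b * |c|) / 2) (-b) (-c)) :=
  h.tail (Or.inl ⟨2, (TM_mut2 a b c).symm⟩)
theorem eq_rot {B : Matrix (Fin 3) (Fin 3) ℝ} {a b c : ℝ} (h : MutationEquiv B (TM a b c)) :
    MutationEquiv B (TM b c a) :=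
  h.tail (Or.inr ⟨finRotate 3, (TM_rot a b c).symm⟩)
theorem eq_swap {B : Matrix (Fin 3) (Fin 3) ℝ} {a b c : ℝ} (h : MutationEquiv B (TM a b c)) :
    MutationEquiv B (TM (-b) (-a) (-c)) :=
  h.tail (Or.inr ⟨Equiv.swap 0 2, (TM_swap a b c).symm⟩)

theorem Rch.rot {B : Matrix (Fin 3) (Fin 3) ℝ} {x y z : ℝ} (h : Rch B x y z) : Rch B y z x := by
  obtain ⟨a, b, c, h1, h2, h3, h4, h5⟩ := h
  refine ⟨b, c, a, eq_rot h1, h3, h4, h2, ?_⟩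
  rw [show y * z * x = x * y * z by ring, ← h5]
  unfold Cyc; tauto

theorem Rch.swp {B : Matrix (Fin 3) (Fin 3) ℝ} {x y z : ℝ} (h : Rch B x y z) : Rch B y x z := by
  obtain ⟨a, b, c, h1, h2, h3, h4, h5⟩ := h
  refine ⟨-b, -a, -c, eq_swap h1, by rwa [abs_neg], by rwa [abs_neg], by rwa [abs_neg], ?_⟩
  rw [show y * x * z = x * y * z by ring, ← h5]
  unfold Cyc
  simp only [Left.neg_pos_iff, Left.neg_neg_iff]
  tauto

theorem Rch.sgn {B : Matrix (Fin 3) (Fin 3) ℝ} {x y z : ℝ} (h : Rch B x y z) :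
    Rch B (-x) (-y) z := by
  obtain ⟨a, b, c, h1, h2, h3, h4, h5⟩ := h
  refine ⟨a, b, c, h1, by rwa [abs_neg], by rwa [abs_neg], h4, ?_⟩
  rw [h5, neg_mul_neg]

theorem same_sign {c z : ℝ} (h : |c| = |z|) (h' : 0 < c ↔ 0 < z) : c = z := by
  rcases abs_eq_abs.1 h with h1 | h1
  · exact h1
  · rcases lt_trichotomy z 0 with h2 | h2 | h2
    · have := h'.1 (by linarith); linarith
    · linarith
    · have := h'.2 h2; linarith

/-- the case where the two arrows at the middle vertex go through, positive orientation -/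
theorem Rch.vie_pos {B : Matrix (Fin 3) (Fin 3) ℝ} {x y z a b c : ℝ}
    (h1 : MutationEquiv B (TM a b c)) (h2 : |a| = |x|) (h3 : |b| = |y|) (h4 : |c| = |z|)
    (h5 : Cyc a b c ↔ 0 < x * y * z) (ha : 0 < a) (hb : 0 < b) : Rch B x y (x * y - z) := by
  have hm := eq_mut1 h1
  rw [abs_of_pos ha, abs_of_pos hb, show c - (a * b + a * b) / 2 = c - a * b by ring] at hm
  have hxy : |x * y| = a * b := by rw [abs_mul, ← h2, ← h3, abs_of_pos ha, abs_of_pos hb]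
  have hab : 0 < a * b := mul_pos ha hb
  have hcyc : Cyc a b c ↔ 0 < c := by
    unfold Cyc
    constructor
    · rintro (h | h)
      · exact h.2.2
      · linarith
    · intro h; exact Or.inl ⟨ha, hb, h⟩
  have hcyc' : Cyc (-a) (-b) (c - a * b) ↔ c < a * b := by
    unfold Cyc
    constructor
    · rintro (h | h)
      · linarith
      · linarith
    · intro h; exact Or.inr ⟨by linarith, by linarith, by linarith⟩
  rw [hcyc] at h5
  refine ⟨-a, -b, c - a * b, hm, by rwa [abs_neg], by rwa [abs_neg], ?_, ?_⟩
  · rcases lt_or_ge 0 (x * y) with hp | hp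
    · rw [abs_of_pos hp] at hxy
      have : c = z := same_sign h4 (by rw [h5]; exact mul_pos_iff_of_pos_left hp)
      rw [this, hxy, abs_sub_comm]
    · rw [abs_of_nonpos hp] at hxy
      have hp' : x * y < 0 := by linarith
      have : c = -z := same_sign (by rw [abs_neg, h4]) (by
        rw [h5, show x * y * z = -(x * y) * -z by ring]; exact mul_pos_iff_of_pos_left (by linarith))
      rw [this, ← hxy]; congr 1; ring
  · rw [hcyc']
    rcases lt_or_ge 0 (x * y) with hp | hp
    · rw [abs_of_pos hp] at hxy
      have : c = z := same_sign h4 (by rw [h5]; exact mul_pos_iff_of_pos_left hp)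
      rw [mul_pos_iff_of_pos_left hp, this, hxy, sub_pos]
    · rw [abs_of_nonpos hp] at hxy
      have hp' : x * y < 0 := by linarith
      have : c = -z := same_sign (by rw [abs_neg, h4]) (by
        rw [h5, show x * y * z = -(x * y) * -z by ring]; exact mul_pos_iff_of_pos_left (by linarith))
      rw [show x * y * (x * y - z) = -(x * y) * (z - x * y) by ring,
        mul_pos_iff_of_pos_left (by linarith : 0 < -(x * y)), this, ← hxy]
      constructor <;> intro <;> linarith

theorem Rch.vie {B : Matrix (Fin 3) (Fin 3) ℝ} {x y z : ℝ} (h : Rch B x y z) :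
    Rch B x y (x * y - z) := by
  obtain ⟨a, b, c, h1, h2, h3, h4, h5⟩ := h
  -- negative orientation
  have neg : ∀ a b c : ℝ, MutationEquiv B (TM a b c) → |a| = |x| → |b| = |y| → |c| = |z| →
      (Cyc a b c ↔ 0 < x * y * z) → a < 0 → b < 0 → Rch B x y (x * y - z) := by
    intro a b c h1 h2 h3 h4 h5 ha hb
    have := Rch.vie_pos (x := y) (y := x) (z := z) (eq_swap h1) (by rwa [abs_neg]) (by rwa [abs_neg])
      (by rwa [abs_neg]) (by
        rw [show y * x * z = x * y * z by ring, ← h5]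
        unfold Cyc
        simp only [Left.neg_pos_iff, Left.neg_neg_iff]
        tauto) (by linarith) (by linarith)
    have := this.swp
    rwa [mul_comm y x] at this
  have zero : x * y = 0 → Rch B x y (x * y - z) := by
    intro h0
    refine ⟨a, b, c, h1, h2, h3, by rw [h0, zero_sub, abs_neg, h4], ?_⟩
    rw [h5, h0]; simp
  rcases lt_trichotomy a 0 with ha | ha | ha
  · rcases lt_trichotomy b 0 with hb | hb | hb
    · exact neg a b c h1 h2 h3 h4 h5 ha hb
    · apply zero
      rw [hb, abs_zero] at h3
      rw [abs_eq_zero.1 h3.symm, mul_zero]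
    · have hn : ¬ Cyc a b c := by rintro (h | h) <;> linarith
      rcases le_or_gt c 0 with hc | hc
      · have hm := eq_mut2 h1
        rw [abs_of_pos hb, abs_of_nonpos hc, show a - (b * c + b * -c) / 2 = a by ring] at hm
        refine neg a (-b) (-c) hm h2 (by rwa [abs_neg]) (by rwa [abs_neg]) ?_ ha (by linarith)
        rw [← h5]
        refine iff_of_false ?_ hn
        rintro (h | h) <;> linarith
      · have hm := eq_mut0 h1
        rw [abs_of_neg ha, abs_of_pos hc, show b - (-a * c + a * c) / 2 = b by ring] at hm
        refine Rch.vie_pos hm (by rwa [abs_neg]) h3 (by rwa [abs_neg]) ?_ (by linarith) hb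
        rw [← h5]
        refine iff_of_false ?_ hn
        rintro (h | h) <;> linarith
  · apply zero
    rw [ha, abs_zero] at h2
    rw [abs_eq_zero.1 h2.symm, zero_mul]
  · rcases lt_trichotomy b 0 with hb | hb | hb
    · have hn : ¬ Cyc a b c := by rintro (h | h) <;> linarith
      rcases le_or_gt 0 c with hc | hc
      · have hm := eq_mut2 h1
        rw [abs_of_neg hb, abs_of_nonneg hc, show a - (-b * c + b * c) / 2 = a by ring] at hm
        refine Rch.vie_pos hm h2 (by rwa [abs_neg]) (by rwa [abs_neg]) ?_ ha (by linarith)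
        rw [← h5]
        refine iff_of_false ?_ hn
        rintro (h | h) <;> linarith
      · have hm := eq_mut0 h1
        rw [abs_of_pos ha, abs_of_neg hc, show b - (a * c + a * -c) / 2 = b by ring] at hm
        refine neg (-a) b (-c) hm (by rwa [abs_neg]) h3 (by rwa [abs_neg]) ?_ (by linarith) hb
        rw [← h5]
        refine iff_of_false ?_ hn
        rintro (h | h) <;> linarith
    · apply zero
      rw [hb, abs_zero] at h3
      rw [abs_eq_zero.1 h3.symm, mul_zero]
    · exact Rch.vie_pos h1 h2 h3 h4 h5 ha hb

theorem finite_abs {S : Set ℝ} (hS : S.Finite) : {x : ℝ | |x| ∈ S}.Finite := by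
  refine (hS.union (hS.image (fun x => -x))).subset ?_
  intro x hx
  rcases abs_choice x with h | h
  · left
    have : |x| ∈ S := hx
    rwa [h] at this
  · right
    exact ⟨|x|, hx, by rw [h]; simp⟩

theorem finite_triple {S : Set ℝ} (hS : S.Finite) :
    {p : ℝ × ℝ × ℝ | |p.1| ∈ S ∧ |p.2.1| ∈ S ∧ |p.2.2| ∈ S}.Finite := by
  have h := finite_abs hS
  refine (h.prod (h.prod h)).subset ?_
  rintro ⟨x, y, z⟩ ⟨h1, h2, h3⟩
  exact ⟨h1, h2, h3⟩

theorem Rch.finite {B : Matrix (Fin 3) (Fin 3) ℝ} (h : {B' | MutationEquiv B B'}.Finite) :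
    {p : ℝ × ℝ × ℝ | Rch B p.1 p.2.1 p.2.2}.Finite := by
  have h1 := h.image (fun C => |C 0 1|)
  have h2 := h.image (fun C => |C 1 2|)
  have h3 := h.image (fun C => |C 2 0|)
  refine (finite_triple ((h1.union h2).union h3)).subset ?_
  rintro ⟨x, y, z⟩ ⟨a, b, c, e, h4, h5, h6, -⟩
  refine ⟨Or.inl (Or.inl ⟨_, e, ?_⟩), Or.inl (Or.inr ⟨_, e, ?_⟩), Or.inr ⟨_, e, ?_⟩⟩
  · simpa [TM] using h4
  · simpa [TM] using h5
  · simpa [TM] using h6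

open Classical in
/-- sign of the normalised triple -/
def sg (a b c : ℝ) : ℝ := if Cyc a b c then 1 else -1

theorem sg_congr {a b c a' b' c' : ℝ} (h : Cyc a b c ↔ Cyc a' b' c') : sg a b c = sg a' b' c' := by
  unfold sg
  by_cases hc : Cyc a b c
  · rw [if_pos hc, if_pos (h.1 hc)]
  · rw [if_neg hc, if_neg (fun h' => hc (h.2 h'))]

theorem Rch.base {B : Matrix (Fin 3) (Fin 3) ℝ} {a b c : ℝ} (h : MutationEquiv B (TM a b c)) :
    Rch B (sg a b c * |a|) (sg a b c * |b|) (sg a b c * |c|) := by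
  unfold sg
  split_ifs with hc
  · refine ⟨a, b, c, h, by simp, by simp, by simp, iff_of_true hc ?_⟩
    have : a ≠ 0 ∧ b ≠ 0 ∧ c ≠ 0 := by
      rcases hc with h | h
      · exact ⟨h.1.ne', h.2.1.ne', h.2.2.ne'⟩
      · exact ⟨h.1.ne, h.2.1.ne, h.2.2.ne⟩
    obtain ⟨h1, h2, h3⟩ := this
    simp only [one_mul]
    positivity
  · refine ⟨a, b, c, h, by simp, by simp, by simp, iff_of_false hc ?_⟩
    have : 0 ≤ |a| * |b| * |c| := by positivity
    nlinarith

theorem forward {B : Matrix (Fin 3) (Fin 3) ℝ} {a b c : ℝ} (hB : B = TM a b c)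
    (hc : ¬ (a = 0 ∧ b = 0) ∧ ¬ (b = 0 ∧ c = 0) ∧ ¬ (a = 0 ∧ c = 0))
    (h : {B' | MutationEquiv B B'}.Finite) :
    Rch B 2 2 2 ∨ (∃ n : ℕ, 3 ≤ n ∧ Rch B (2 * Real.cos (Real.pi / n)) (2 * Real.cos (Real.pi / n)) 2) ∨
    Rch B 1 1 0 ∨ Rch B 1 (Real.sqrt 2) 0 ∨ Rch B 1 (2 * Real.cos (Real.pi / 5)) 0 ∨
    Rch B (2 * Real.cos (Real.pi / 5)) (2 * Real.cos (2 * Real.pi / 5)) 0 ∨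
    Rch B 1 (2 * Real.cos (2 * Real.pi / 5)) 0 := by
  have hb : Rch B (sg a b c * |a|) (sg a b c * |b|) (sg a b c * |c|) :=
    Rch.base (by rw [← hB]; exact .refl)
  have hs : sg a b c ≠ 0 := by unfold sg; split_ifs <;> norm_num
  have key : ∀ {x y z}, Orb (sg a b c * |a|) (sg a b c * |b|) (sg a b c * |c|) x y z → Rch B x y z :=
    fun h => Orb.mono hb Rch.rot Rch.swp Rch.sgn Rch.vie h
  have hfin : (OrbSet (sg a b c * |a|) (sg a b c * |b|) (sg a b c * |c|)).Finite := by
    refine (Rch.finite h).subset ?_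
    rintro ⟨x, y, z⟩ hp
    exact key hp
  have hFO := Orb.toFO hfin (by simpa [hs] using hc)
  rcases hFO.final .base with h | ⟨n, hn, h⟩ | h | h | h | h | h
  · exact Or.inl (key h)
  · exact Or.inr (Or.inl ⟨n, hn, key h⟩)
  · exact Or.inr (Or.inr (Or.inl (key h)))
  · exact Or.inr (Or.inr (Or.inr (Or.inl (key h))))
  · exact Or.inr (Or.inr (Or.inr (Or.inr (Or.inl (key h)))))
  · exact Or.inr (Or.inr (Or.inr (Or.inr (Or.inr (Or.inl (key h))))))
  · exact Or.inr (Or.inr (Or.inr (Or.inr (Or.inr (Or.inr (key h))))))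

theorem Rch.to_cyc {B : Matrix (Fin 3) (Fin 3) ℝ} {x z : ℝ} (hx : 0 < x) (hz : 0 < z)
    (h : Rch B x x z) : MutationEquiv B (TM x x z) := by
  obtain ⟨a, b, c, h1, h2, h3, h4, h5⟩ := h
  rw [abs_of_pos hx] at h2 h3
  rw [abs_of_pos hz] at h4
  rcases h5.2 (by positivity) with ⟨p, q, r⟩ | ⟨p, q, r⟩
  · rw [abs_of_pos p] at h2
    rw [abs_of_pos q] at h3
    rw [abs_of_pos r] at h4
    rwa [h2, h3, h4] at h1
  · rw [abs_of_neg p] at h2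
    rw [abs_of_neg q] at h3
    rw [abs_of_neg r] at h4
    have := eq_swap h1
    rwa [h2, h3, h4] at this

theorem Rch.to_ac {B : Matrix (Fin 3) (Fin 3) ℝ} {x y : ℝ} (hx : 0 ≤ x) (hy : 0 ≤ y)
    (h : Rch B x y 0) : MutationEquiv B (TM x y 0) := by
  obtain ⟨a, b, c, h1, h2, h3, h4, -⟩ := h
  rw [abs_of_nonneg hx] at h2
  rw [abs_of_nonneg hy] at h3
  rw [abs_zero, abs_eq_zero] at h4
  subst h4
  have A : MutationEquiv B (TM x b 0) := by
    rcases abs_choice a with h | h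
    · rwa [← h2, h]
    · have := eq_mut0 h1
      simp only [mul_zero, abs_zero, add_zero, zero_div, sub_zero, neg_zero] at this
      rwa [← h2, h]
  rcases abs_choice b with h | h
  · rwa [← h3, h]
  · have := eq_mut2 A
    simp only [mul_zero, abs_zero, add_zero, zero_div, sub_zero, neg_zero] at this
    rwa [← h3, h]

theorem markovQ_eq : markovQ = TM 2 2 2 := rfl
theorem cycQ_eq (n : ℕ) : cycQ n = TM (2 * Real.cos (Real.pi / n)) (2 * Real.cos (Real.pi / n)) 2 := rfl
theorem acQ_eq (p q : ℝ) : acQ p q = TM p q 0 := by unfold acQ TM; simp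

/-- converse: finite orbit gives finite class -/
theorem class_finite {a b c : ℝ}
    (hf : (OrbSet (sg a b c * |a|) (sg a b c * |b|) (sg a b c * |c|)).Finite) :
    {B' | MutationEquiv (TM a b c) B'}.Finite := by
  set F := Orb (sg a b c * |a|) (sg a b c * |b|) (sg a b c * |c|) with hF
  have rot : ∀ {x y z}, F x y z → F y z x := Orb.rot
  have swp : ∀ {x y z}, F x y z → F y x z := Orb.swp
  have sgn : ∀ {x y z}, F x y z → F (-x) (-y) z := Orb.sgn
  have vie : ∀ {x y z}, F x y z → F x y (x * y - z) := Orb.vie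
  let G : ℝ → ℝ → ℝ → Prop := fun x y z => F (sg x y z * |x|) (sg x y z * |y|) (sg x y z * |z|)
  have sgrot : ∀ x y z, sg y z x = sg x y z := by
    intro x y z
    have : Cyc y z x ↔ Cyc x y z := by unfold Cyc; tauto
    exact sg_congr this
  have sgswap : ∀ x y z, sg (-y) (-x) (-z) = sg x y z := by
    intro x y z
    have : Cyc (-y) (-x) (-z) ↔ Cyc x y z := by
      unfold Cyc
      simp only [Left.neg_pos_iff, Left.neg_neg_iff]
      tauto
    exact sg_congr this
  have hr : ∀ x y z, G x y z → G y z x := by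
    intro x y z h
    change F _ _ _
    rw [sgrot]
    exact rot h
  have hs : ∀ x y z, G x y z → G (-y) (-x) (-z) := by
    intro x y z h
    change F _ _ _
    rw [sgswap, abs_neg, abs_neg, abs_neg]
    exact swp h
  -- positive pairs
  have gpos : ∀ x y z, 0 < x → 0 < y → (G x y z ↔ F x y z) := by
    intro x y z hx hy
    change F _ _ _ ↔ _
    rw [abs_of_pos hx, abs_of_pos hy]
    unfold sg
    split_ifs with h
    · rcases h with h | h
      · rw [abs_of_pos h.2.2]; simp
      · linarith
    · have hz : z ≤ 0 := by
        by_contra hz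
        exact h (Or.inl ⟨hx, hy, by linarith⟩)
      rw [abs_of_nonpos hz]
      have e : -1 * -z = z := by ring
      rw [e]
      constructor
      · intro h
        have := sgn h
        simpa using this
      · intro h
        have := sgn h
        simpa using this
  have gpos' : ∀ x y z, x < 0 → y < 0 → (G x y z ↔ F (-x) (-y) (-z)) := by
    intro x y z hx hy
    rw [← gpos (-x) (-y) (-z) (by linarith) (by linarith)]
    constructor
    · intro h
      change F _ _ _ at h
      change F _ _ _
      have e : sg (-x) (-y) (-z) = sg x y z := by
        rw [← sgswap x y z]
        have : Cyc (-x) (-y) (-z) ↔ Cyc (-y) (-x) (-z) := by unfold Cyc; tauto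
        exact sg_congr this
      rw [e, abs_neg, abs_neg, abs_neg]; exact h
    · intro h
      change F _ _ _ at h
      change F _ _ _
      have e : sg (-x) (-y) (-z) = sg x y z := by
        rw [← sgswap x y z]
        have : Cyc (-x) (-y) (-z) ↔ Cyc (-y) (-x) (-z) := by unfold Cyc; tauto
        exact sg_congr this
      rw [e, abs_neg, abs_neg, abs_neg] at h; exact h
  have hm : ∀ x y z, G x y z → G (-x) (-y) (z - (|x| * y + x * |y|) / 2) := by
    intro x y z h
    by_cases hp : 0 < x ∧ 0 < y
    · obtain ⟨hx, hy⟩ := hp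
      rw [gpos' _ _ _ (by linarith) (by linarith)]
      rw [gpos _ _ _ hx hy] at h
      rw [abs_of_pos hx, abs_of_pos hy]
      convert vie h using 1 <;> ring
    · by_cases hn : x < 0 ∧ y < 0
      · obtain ⟨hx, hy⟩ := hn
        rw [gpos _ _ _ (by linarith) (by linarith)]
        rw [gpos' _ _ _ hx hy] at h
        rw [abs_of_neg hx, abs_of_neg hy]
        convert vie h using 1; ring
      · have e0 : (|x| * y + x * |y|) / 2 = 0 := by
          rcases lt_trichotomy x 0 with hx | hx | hx
          · have hy : 0 ≤ y := by by_contra hy; exact hn ⟨hx, by linarith⟩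
            rw [abs_of_neg hx, abs_of_nonneg hy]; ring
          · subst hx; simp
          · have hy : y ≤ 0 := by by_contra hy; exact hp ⟨hx, by linarith⟩
            rw [abs_of_pos hx, abs_of_nonpos hy]; ring
        rw [e0, sub_zero]
        change F _ _ _ at h
        change F _ _ _
        have e1 : sg (-x) (-y) z = -1 := by
          unfold sg
          rw [if_neg]
          rintro (h | h)
          · exact hn ⟨by linarith, by linarith⟩
          · exact hp ⟨by linarith, by linarith⟩
        have e2 : sg x y z = -1 := by
          unfold sg
          rw [if_neg]
          rintro (h | h)
          · exact hp ⟨by linarith, by linarith⟩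
          · exact hn ⟨by linarith, by linarith⟩
        rw [e1, abs_neg, abs_neg]
        rwa [e2] at h
  have hbase : G a b c := Orb.base
  have hfin : {p : ℝ × ℝ × ℝ | G p.1 p.2.1 p.2.2}.Finite := by
    have h1 := hf.image (fun p => |p.1|)
    have h2 := hf.image (fun p => |p.2.1|)
    have h3 := hf.image (fun p => |p.2.2|)
    refine (finite_triple ((h1.union h2).union h3)).subset ?_
    rintro ⟨x, y, z⟩ hp
    have hsg : |sg x y z| = 1 := by unfold sg; split_ifs <;> simp
    have hp' : (sg x y z * |x|, sg x y z * |y|, sg x y z * |z|) ∈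
      OrbSet (sg a b c * |a|) (sg a b c * |b|) (sg a b c * |c|) := hp
    refine ⟨Or.inl (Or.inl ⟨_, hp', ?_⟩), Or.inl (Or.inr ⟨_, hp', ?_⟩), Or.inr ⟨_, hp', ?_⟩⟩
    · simp [abs_mul, hsg]
    · simp [abs_mul, hsg]
    · simp [abs_mul, hsg]
  refine (hfin.image (fun p => TM p.1 p.2.1 p.2.2)).subset ?_
  intro B' hB'
  obtain ⟨x, y, z, rfl, hG⟩ := equiv_closed G hr hs hm hbase hB'
  exact ⟨(x, y, z), hG, rfl⟩

theorem fin_of_list {R : Type*} [CommRing R] (D : List R) (M a b c : R)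
    (ha : a ∈ D) (hb : b ∈ D) (hc : c ∈ D) (hM : a * a + b * b + c * c - a * b * c = M)
    (hneg : ∀ x ∈ D, -x ∈ D)
    (hv : ∀ x ∈ D, ∀ y ∈ D, ∀ z ∈ D, x * x + y * y + z * z - x * y * z = M → x * y - z ∈ D) :
    (OrbSet a b c).Finite := by
  have hD : {x | x ∈ D}.Finite := List.finite_toSet D
  refine (hD.prod (hD.prod hD)).subset ?_
  rintro ⟨x, y, z⟩ hp
  have := Orb.mono (O := fun x y z => x ∈ D ∧ y ∈ D ∧ z ∈ D ∧
    x * x + y * y + z * z - x * y * z = M) ⟨ha, hb, hc, hM⟩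
    (fun h => ⟨h.2.1, h.2.2.1, h.1, by rw [← h.2.2.2]; ring⟩)
    (fun h => ⟨h.2.1, h.1, h.2.2.1, by rw [← h.2.2.2]; ring⟩)
    (fun h => ⟨hneg _ h.1, hneg _ h.2.1, h.2.2.1, by rw [← h.2.2.2]; ring⟩)
    (fun h => ⟨h.1, h.2.1, hv _ h.1 _ h.2.1 _ h.2.2.1 h.2.2.2, by rw [← h.2.2.2]; ring⟩) hp
  exact ⟨this.1, this.2.1, this.2.2.1⟩

theorem ac_finite {R : Type*} [CommRing R] (f : R →+* ℝ) (p q : R) (hp : 0 ≤ f p) (hq : 0 ≤ f q)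
    (h : (OrbSet (-p) (-q) 0).Finite) : {B' | MutationEquiv (acQ (f p) (f q)) B'}.Finite := by
  rw [acQ_eq]
  apply class_finite
  have e : sg (f p) (f q) 0 = -1 := by
    unfold sg
    rw [if_neg]
    rintro (h | h) <;> exact absurd h.2.2 (lt_irrefl _)
  rw [e, abs_of_nonneg hp, abs_of_nonneg hq, abs_zero]
  have := Orb.fin_map f h
  simpa using this

abbrev Qphi := QuadraticAlgebra ℤ 1 1
def Dphi : List Qphi := [⟨0, 0⟩, ⟨1, 0⟩, ⟨-1, 0⟩, ⟨0, 1⟩, ⟨0, -1⟩, ⟨-1, 1⟩, ⟨1, -1⟩]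

abbrev Qtwo := QuadraticAlgebra ℤ 2 0
def Dtwo : List Qtwo := [⟨0, 0⟩, ⟨1, 0⟩, ⟨-1, 0⟩, ⟨0, 1⟩, ⟨0, -1⟩]

theorem Dphi_neg : ∀ x ∈ Dphi, -x ∈ Dphi := by decide +kernel

theorem orb_phi1 : (OrbSet (-⟨1, 0⟩ : Qphi) (-⟨0, 1⟩) 0).Finite :=
  fin_of_list Dphi ⟨2, 1⟩ _ _ _ (by decide +kernel) (by decide +kernel) (by decide +kernel)
    (by decide +kernel) Dphi_neg (by decide +kernel)
theorem orb_phi2 : (OrbSet (-⟨0, 1⟩ : Qphi) (-⟨-1, 1⟩) 0).Finite :=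
  fin_of_list Dphi ⟨3, 0⟩ _ _ _ (by decide +kernel) (by decide +kernel) (by decide +kernel)
    (by decide +kernel) Dphi_neg (by decide +kernel)
theorem orb_phi3 : (OrbSet (-⟨1, 0⟩ : Qphi) (-⟨-1, 1⟩) 0).Finite :=
  fin_of_list Dphi ⟨3, -1⟩ _ _ _ (by decide +kernel) (by decide +kernel) (by decide +kernel)
    (by decide +kernel) Dphi_neg (by decide +kernel)
theorem orb_two : (OrbSet (-⟨1, 0⟩ : Qtwo) (-⟨0, 1⟩) 0).Finite :=
  fin_of_list Dtwo ⟨3, 0⟩ _ _ _ (by decide +kernel) (by decide +kernel) (by decide +kernel)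
    (by decide +kernel) (by decide +kernel) (by decide +kernel)
theorem orb_one : (OrbSet (-1 : ℤ) (-1) 0).Finite :=
  fin_of_list [0, 1, -1] 2 _ _ _ (by decide +kernel) (by decide +kernel) (by decide +kernel)
    (by decide +kernel) (by decide +kernel) (by decide +kernel)

theorem phi_sq : (2 * Real.cos (Real.pi / 5)) * (2 * Real.cos (Real.pi / 5)) =
    (1 : ℤ) • 1 + (1 : ℤ) • (2 * Real.cos (Real.pi / 5)) := by
  rw [Real.cos_pi_div_five]
  have h5 : Real.sqrt 5 ^ 2 = 5 := Real.sq_sqrt (by norm_num)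
  simp only [one_smul]
  nlinarith

theorem psi_eq : 2 * Real.cos (2 * Real.pi / 5) = 2 * Real.cos (Real.pi / 5) - 1 := by
  rw [show 2 * Real.pi / 5 = 2 * (Real.pi / 5) by ring, Real.cos_two_mul]
  have := phi_sq
  simp only [one_smul] at this
  linarith

def fphi : Qphi →+* ℝ := (QuadraticAlgebra.lift ⟨2 * Real.cos (Real.pi / 5), phi_sq⟩).toRingHom

theorem fphi_apply (a b : ℤ) : fphi ⟨a, b⟩ = a + b * (2 * Real.cos (Real.pi / 5)) := by
  change a • (1 : ℝ) + b • (2 * Real.cos (Real.pi / 5)) = _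
  simp

theorem two_sq : Real.sqrt 2 * Real.sqrt 2 = (2 : ℤ) • 1 + (0 : ℤ) • Real.sqrt 2 := by
  rw [Real.mul_self_sqrt (by norm_num)]; simp

def ftwo : Qtwo →+* ℝ := (QuadraticAlgebra.lift ⟨Real.sqrt 2, two_sq⟩).toRingHom

theorem ftwo_apply (a b : ℤ) : ftwo ⟨a, b⟩ = a + b * Real.sqrt 2 := by
  change a • (1 : ℝ) + b • (Real.sqrt 2) = _
  simp

theorem fphi_one : fphi ⟨1, 0⟩ = 1 := by rw [fphi_apply]; simp
theorem fphi_phi : fphi ⟨0, 1⟩ = 2 * Real.cos (Real.pi / 5) := by rw [fphi_apply]; simp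
theorem fphi_psi : fphi ⟨-1, 1⟩ = 2 * Real.cos (2 * Real.pi / 5) := by
  rw [fphi_apply, psi_eq]; push_cast; ring
theorem ftwo_one : ftwo ⟨1, 0⟩ = 1 := by rw [ftwo_apply]; simp
theorem ftwo_two : ftwo ⟨0, 1⟩ = Real.sqrt 2 := by rw [ftwo_apply]; simp

theorem phi_pos : 0 < 2 * Real.cos (Real.pi / 5) := by
  have : 0 < Real.cos (Real.pi / 5) :=
    Real.cos_pos_of_mem_Ioo ⟨by linarith [Real.pi_pos], by linarith [Real.pi_pos]⟩
  linarith
theorem psi_pos : 0 < 2 * Real.cos (2 * Real.pi / 5) := by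
  have : 0 < Real.cos (2 * Real.pi / 5) :=
    Real.cos_pos_of_mem_Ioo ⟨by linarith [Real.pi_pos], by linarith [Real.pi_pos]⟩
  linarith

theorem ac1_finite : {B' | MutationEquiv (acQ 1 1) B'}.Finite := by
  have := ac_finite (Int.castRingHom ℝ) 1 1 (by simp) (by simp) orb_one
  simpa using this
theorem ac2_finite : {B' | MutationEquiv (acQ 1 (Real.sqrt 2)) B'}.Finite := by
  have := ac_finite ftwo ⟨1, 0⟩ ⟨0, 1⟩ (by rw [ftwo_one]; norm_num)
    (by rw [ftwo_two]; positivity) orb_two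
  rwa [ftwo_one, ftwo_two] at this
theorem ac3_finite : {B' | MutationEquiv (acQ 1 (2 * Real.cos (Real.pi / 5))) B'}.Finite := by
  have := ac_finite fphi ⟨1, 0⟩ ⟨0, 1⟩ (by rw [fphi_one]; norm_num)
    (by rw [fphi_phi]; exact phi_pos.le) orb_phi1
  rwa [fphi_one, fphi_phi] at this
theorem ac4_finite : {B' | MutationEquiv
    (acQ (2 * Real.cos (Real.pi / 5)) (2 * Real.cos (2 * Real.pi / 5))) B'}.Finite := by
  have := ac_finite fphi ⟨0, 1⟩ ⟨-1, 1⟩ (by rw [fphi_phi]; exact phi_pos.le)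
    (by rw [fphi_psi]; exact psi_pos.le) orb_phi2
  rwa [fphi_phi, fphi_psi] at this
theorem ac5_finite : {B' | MutationEquiv (acQ 1 (2 * Real.cos (2 * Real.pi / 5))) B'}.Finite := by
  have := ac_finite fphi ⟨1, 0⟩ ⟨-1, 1⟩ (by rw [fphi_one]; norm_num)
    (by rw [fphi_psi]; exact psi_pos.le) orb_phi3
  rwa [fphi_one, fphi_psi] at this

theorem orb_markov : (OrbSet (2 : ℤ) 2 2).Finite :=
  fin_of_list [2, -2] 4 _ _ _ (by decide +kernel) (by decide +kernel) (by decide +kernel)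
    (by decide +kernel) (by decide +kernel) (by decide +kernel)

theorem markov_finite : {B' | MutationEquiv markovQ B'}.Finite := by
  rw [markovQ_eq]
  apply class_finite
  have e : sg 2 2 2 = 1 := by
    unfold sg
    rw [if_pos]
    left; norm_num
  rw [e]
  have := Orb.fin_map (Int.castRingHom ℝ) orb_markov
  simpa using this

theorem cos_finite (n : ℕ) (hn : 0 < n) :
    {x : ℝ | ∃ a : ℤ, x = 2 * Real.cos (a * Real.pi / n)}.Finite := by
  refine ((Set.finite_Ico (0 : ℤ) (2 * n)).image (fun a : ℤ => 2 * Real.cos (a * Real.pi / n))).subset ?_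
  rintro x ⟨a, rfl⟩
  have h2n : (0 : ℤ) < 2 * n := by positivity
  refine ⟨a % (2 * n), ⟨Int.emod_nonneg _ h2n.ne', Int.emod_lt_of_pos _ h2n⟩, ?_⟩
  have hnR : (n : ℝ) ≠ 0 := by exact_mod_cast hn.ne'
  have h1 : ((a % (2 * n) : ℤ) : ℝ) = a - 2 * n * (a / (2 * n) : ℤ) := by
    have := Int.emod_add_mul_ediv a (2 * n)
    have h : ((a % (2 * n) + 2 * n * (a / (2 * n)) : ℤ) : ℝ) = (a : ℝ) := by rw [this]
    push_cast at h ⊢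
    linarith
  have h2 : ((a % (2 * n) : ℤ) : ℝ) * Real.pi / n =
      a * Real.pi / n - ((a / (2 * n) : ℤ) : ℝ) * (2 * Real.pi) := by
    rw [h1]; field_simp
  simp only
  rw [h2, Real.cos_sub_int_mul_two_pi]

theorem orb_cyc (n : ℕ) (hn : 0 < n) (a b : ℤ) :
    (OrbSet (2 * Real.cos (a * Real.pi / n)) (2 * Real.cos (b * Real.pi / n))
      (2 * Real.cos ((a + b : ℤ) * Real.pi / n))).Finite := by
  have hD := cos_finite n hn
  have hnR : (n : ℝ) ≠ 0 := by exact_mod_cast hn.ne'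
  refine (hD.prod (hD.prod hD)).subset ?_
  rintro ⟨x, y, z⟩ hp
  have key := Orb.mono (O := fun x y z => ∃ a b : ℤ, x = 2 * Real.cos (a * Real.pi / n) ∧
    y = 2 * Real.cos (b * Real.pi / n) ∧ z = 2 * Real.cos ((a + b : ℤ) * Real.pi / n))
    ⟨a, b, rfl, rfl, rfl⟩ ?_ ?_ ?_ ?_ hp
  · obtain ⟨a, b, h1, h2, h3⟩ := key
    exact ⟨⟨a, h1⟩, ⟨b, h2⟩, ⟨a + b, h3⟩⟩
  · rintro x y z ⟨a, b, rfl, rfl, rfl⟩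
    refine ⟨b, -(a + b), rfl, ?_, ?_⟩
    · rw [← Real.cos_neg]; congr 2; push_cast; ring
    · rw [← Real.cos_neg]; congr 2; push_cast; ring
  · rintro x y z ⟨a, b, rfl, rfl, rfl⟩
    exact ⟨b, a, rfl, rfl, by rw [add_comm]⟩
  · rintro x y z ⟨a, b, rfl, rfl, rfl⟩
    refine ⟨a + n, b - n, ?_, ?_, ?_⟩
    · rw [show ((a + n : ℤ) : ℝ) * Real.pi / n = a * Real.pi / n + Real.pi by
        push_cast; field_simp, Real.cos_add_pi]; ring
    · rw [show ((b - n : ℤ) : ℝ) * Real.pi / n = b * Real.pi / n - Real.pi by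
        push_cast; field_simp, Real.cos_sub_pi]; ring
    · congr 4; ring_nf
  · rintro x y z ⟨a, b, rfl, rfl, rfl⟩
    refine ⟨a, -b, rfl, ?_, ?_⟩
    · rw [← Real.cos_neg]; congr 2; push_cast; ring
    · rw [show ((a + b : ℤ) : ℝ) * Real.pi / n = a * Real.pi / n + b * Real.pi / n by push_cast; ring,
        show ((a + -b : ℤ) : ℝ) * Real.pi / n = a * Real.pi / n - b * Real.pi / n by push_cast; ring,
        Real.cos_add, Real.cos_sub]
      ring

theorem cyc_pos (n : ℕ) (hn : 3 ≤ n) : 0 < 2 * Real.cos (Real.pi / n) := by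
  have h3 : (3 : ℝ) ≤ n := by exact_mod_cast hn
  have : 0 < Real.cos (Real.pi / n) := by
    apply Real.cos_pos_of_mem_Ioo
    have h1 : Real.pi / n ≤ Real.pi / 3 := div_le_div_of_nonneg_left Real.pi_pos.le (by norm_num) h3
    have h2 : 0 < Real.pi / n := div_pos Real.pi_pos (by linarith)
    exact ⟨by linarith [Real.pi_pos], by linarith [Real.pi_pos]⟩
  linarith

theorem cyc_finite (n : ℕ) (hn : 2 ≤ n) : {B' | MutationEquiv (cycQ n) B'}.Finite := by
  rw [cycQ_eq]
  apply class_finite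
  by_cases h2 : n = 2
  · subst h2
    have hc : 2 * Real.cos (Real.pi / (2 : ℕ)) = 0 := by simp
    rw [hc]
    have e : sg 0 0 2 = -1 := by
      unfold sg
      rw [if_neg]
      rintro (h | h) <;> exact absurd h.1 (lt_irrefl _)
    rw [e]
    have := orb_cyc 2 (by norm_num) 1 1
    simpa using this
  · have hp := cyc_pos n (by omega)
    have e : sg (2 * Real.cos (Real.pi / n)) (2 * Real.cos (Real.pi / n)) 2 = 1 := by
      unfold sg
      rw [if_pos]
      left; exact ⟨hp, hp, by norm_num⟩
    rw [e, abs_of_pos hp]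
    have := orb_cyc n (by omega) 1 (-1)
    have e1 : 2 * Real.cos (((-1 : ℤ) : ℝ) * Real.pi / n) = 2 * Real.cos (Real.pi / n) := by
      rw [← Real.cos_neg]; congr 2; push_cast; ring
    rw [e1] at this
    simpa using this

theorem back {B C : Matrix (Fin 3) (Fin 3) ℝ} (hB : Bᵀ = -B) (h : MutationEquiv B C)
    (hC : {B' | MutationEquiv C B'}.Finite) : {B' | MutationEquiv B B'}.Finite := by
  rw [TM_of_skew B hB] at h ⊢
  refine hC.subset ?_
  intro B' hB'
  exact (equiv_symm h).1.trans hB'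


/-- classification of connected rank 3 quivers of finite mutation type. -/
theorem finite_mutation_type_classification
    (B : Matrix (Fin 3) (Fin 3) ℝ) (hB : Bᵀ = -B)
    (hconn : (B 0 1 ≠ 0 ∧ B 0 2 ≠ 0) ∨ (B 0 1 ≠ 0 ∧ B 1 2 ≠ 0) ∨
      (B 0 2 ≠ 0 ∧ B 1 2 ≠ 0)) :
    {B' | MutationEquiv B B'}.Finite ↔
      (MutationEquiv B markovQ ∨
       (∃ n : ℕ, 2 ≤ n ∧ MutationEquiv B (cycQ n)) ∨
       MutationEquiv B (acQ 1 1) ∨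
       MutationEquiv B (acQ 1 (Real.sqrt 2)) ∨
       MutationEquiv B (acQ 1 (2 * Real.cos (Real.pi / 5))) ∨
       MutationEquiv B (acQ (2 * Real.cos (Real.pi / 5)) (2 * Real.cos (2 * Real.pi / 5))) ∨
       MutationEquiv B (acQ 1 (2 * Real.cos (2 * Real.pi / 5)))) := by
  constructor
  · intro hfin
    have hneg : B 0 2 = - B 2 0 := by
      have := congrFun (congrFun hB 2) 0
      simpa using this
    have hc : ¬ (B 0 1 = 0 ∧ B 1 2 = 0) ∧ ¬ (B 1 2 = 0 ∧ B 2 0 = 0) ∧ ¬ (B 0 1 = 0 ∧ B 2 0 = 0) := by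
      rw [hneg] at hconn
      simp only [ne_eq, neg_eq_zero] at hconn
      tauto
    rcases forward (TM_of_skew B hB) hc hfin with h | ⟨n, hn, h⟩ | h | h | h | h | h
    · left
      rw [markovQ_eq]
      exact h.to_cyc (by norm_num) (by norm_num)
    · right; left
      refine ⟨n, by omega, ?_⟩
      rw [cycQ_eq]
      exact h.to_cyc (cyc_pos n hn) (by norm_num)
    all_goals simp only [acQ_eq]
    · exact Or.inr (Or.inr (Or.inl (h.to_ac (by norm_num) (by norm_num))))
    · exact Or.inr (Or.inr (Or.inr (Or.inl (h.to_ac (by norm_num) (by positivity)))))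
    · exact Or.inr (Or.inr (Or.inr (Or.inr (Or.inl (h.to_ac (by norm_num) phi_pos.le)))))
    · exact Or.inr (Or.inr (Or.inr (Or.inr (Or.inr (Or.inl (h.to_ac phi_pos.le psi_pos.le))))))
    · exact Or.inr (Or.inr (Or.inr (Or.inr (Or.inr (Or.inr (h.to_ac (by norm_num) psi_pos.le))))))
  · rintro (h | ⟨n, hn, h⟩ | h | h | h | h | h)
    · exact back hB h markov_finite
    · exact back hB h (cyc_finite n hn)
    · exact back hB h ac1_finite
    · exact back hB h ac2_finite
    · exact back hB h ac3_finite
    · exact back hB h ac4_finite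
    · exact back hB h ac5_finite
end
end
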